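/- Let n ∈ ℕ, s ∈ (1, n+1)\ℕ and let A be a Young function. Then V^{s,A}_{d,1}(ℝⁿ) is continuously embedded into BMO(ℝⁿ) (i.e., there exists c' > 0 with |u|_{BMO(ℝⁿ)} ≤ c' |∇^{[s]}u|_{{s},A,ℝⁿ} for all u ∈ V^{s,A}_{d,1}(ℝⁿ)) if and only if either (a) s < n and there exists c > 0 such that ∫_0^t Ã(τ) τ^{−1−n/(n+1−s)} dτ ≤ c t^{n/((n−s)(n+1−s))} for all t > 0, or (b) s = n and there exist c > 0, t₀ > 0 such that A(t) ≥ c t for all t ∈ [0,t₀]. -/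

import Mathlib

open MeasureTheory Metric Set Filter
open scoped ENNReal Topology

noncomputable section

/-- Euclidean space `ℝⁿ`. -/
abbrev Euc (n : ℕ) := EuclideanSpace ℝ (Fin n)

/-- A Young function: convex, left-continuous, vanishing at `0`,
non-constant on `(0,∞)`, with values in `[0,∞]`. -/
def IsYoung (A : ℝ → ℝ≥0∞) : Prop :=
  A 0 = 0 ∧
  (∀ x y t : ℝ, 0 ≤ x → 0 ≤ y → 0 ≤ t → t ≤ 1 →
      A (t * x + (1 - t) * y) ≤ ENNReal.ofReal t * A x + ENNReal.ofReal (1 - t) * A y) ∧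
  (∀ t : ℝ, 0 < t → ContinuousWithinAt A (Set.Iic t) t) ∧
  (∃ t₁ t₂ : ℝ, 0 < t₁ ∧ 0 < t₂ ∧ A t₁ ≠ A t₂)

/-- The right-continuous generalized inverse of a monotone function `A : [0,∞) → [0,∞]`. -/
def rcInv (A : ℝ → ℝ≥0∞) (v : ℝ≥0∞) : ℝ :=
  sInf {τ : ℝ | 0 ≤ τ ∧ v < A τ}

/-- The Young conjugate `Ã(t) = sup {τ t - A(τ) : τ ≥ 0}`. -/
def youngConj (A : ℝ → ℝ≥0∞) (t : ℝ) : ℝ≥0∞ :=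
  ⨆ (τ : ℝ) (_ : 0 ≤ τ), ENNReal.ofReal (τ * t) - A τ

/-- The functional `J_{σ,A}(v)` for a vector-valued `v`, with the Euclidean norm. -/
def Jfun (n : ℕ) (σ : ℝ) (A : ℝ → ℝ≥0∞) {ι : Type} [Fintype ι]
    (v : Euc n → ι → ℝ) : ℝ≥0∞ :=
  ∫⁻ x : Euc n, ∫⁻ y : Euc n,
    A (Real.sqrt (∑ i, (v x i - v y i) ^ 2) / ‖x - y‖ ^ σ) /
      ENNReal.ofReal (‖x - y‖ ^ (n : ℝ))

/-- The fractional Orlicz–Sobolev seminorm `|v|_{σ,A,ℝⁿ}` (vector-valued version). -/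
def fracSem (n : ℕ) (σ : ℝ) (A : ℝ → ℝ≥0∞) {ι : Type} [Fintype ι]
    (v : Euc n → ι → ℝ) : ℝ≥0∞ :=
  sInf (ENNReal.ofReal '' {lam : ℝ | 0 < lam ∧ Jfun n σ A (fun x i => v x i / lam) ≤ 1})

/-- The fractional Orlicz–Sobolev seminorm `|u|_{σ,A,ℝⁿ}` of a scalar function. -/
def fracSemS (n : ℕ) (σ : ℝ) (A : ℝ → ℝ≥0∞) (u : Euc n → ℝ) : ℝ≥0∞ :=
  fracSem n σ A (fun x (_ : Fin 1) => u x)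

/-- The normalized mean oscillation `φ(|B|^{1/n})⁻¹ ⨍_B |u - u_B|` over the ball `B = B(x,r)`. -/
def oscQuot (n : ℕ) (φ : ℝ → ℝ) (u : Euc n → ℝ) (x : Euc n) (r : ℝ) : ℝ :=
  (φ ((volume (ball x r)).toReal ^ ((n : ℝ)⁻¹)))⁻¹ *
    ⨍ y in ball x r, |u y - ⨍ z in ball x r, u z|

/-- The Campanato seminorm `|u|_{𝓛^φ(ℝⁿ)}`. -/
def campSem (n : ℕ) (φ : ℝ → ℝ) (u : Euc n → ℝ) : ℝ≥0∞ :=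
  ⨆ (x : Euc n) (r : ℝ) (_ : 0 < r), ENNReal.ofReal (oscQuot n φ u x r)

/-- The Campanato quantity restricted to balls of measure at most `r`. -/
def campSemSmall (n : ℕ) (φ : ℝ → ℝ) (u : Euc n → ℝ) (r : ℝ) : ℝ≥0∞ :=
  ⨆ (x : Euc n) (ρ : ℝ) (_ : 0 < ρ) (_ : volume (ball x ρ) ≤ ENNReal.ofReal r),
    ENNReal.ofReal (oscQuot n φ u x ρ)

/-- `φ : (0,∞) → (0,∞)` is admissible: positive and bounded below away from zero on `[a,∞)`. -/
def Admissible (φ : ℝ → ℝ) : Prop :=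
  (∀ r : ℝ, 0 < r → 0 < φ r) ∧
  ∀ a : ℝ, 0 < a → ∃ ε : ℝ, 0 < ε ∧ ∀ r : ℝ, a ≤ r → ε ≤ φ r

/-- `φ_{s,A}(r) = r^s A⁻¹(r^{-n})`. -/
def phiSA (n : ℕ) (s : ℝ) (A : ℝ → ℝ≥0∞) (r : ℝ) : ℝ :=
  r ^ s * rcInv A (ENNReal.ofReal (r ^ (-(n : ℝ))))

/-- `u` is `m`-times weakly differentiable, with iterated weak partial
derivatives recorded by `D`. -/
def HasWeakDerivs (n m : ℕ) (u : Euc n → ℝ)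
    (D : (h : ℕ) → Euc n → (Fin h → Fin n) → ℝ) : Prop :=
  (∀ x d, D 0 x d = u x) ∧
  ∀ h : ℕ, h ≤ m → ∀ dirs : Fin h → Fin n,
    LocallyIntegrable (fun x => D h x dirs) volume ∧
    ∀ φ : Euc n → ℝ, ContDiff ℝ (⊤ : ℕ∞) φ → HasCompactSupport φ →
      ∫ x : Euc n, u x *
          iteratedFDeriv ℝ h φ x (fun i => EuclideanSpace.single (dirs i) (1 : ℝ)) =
        (-1 : ℝ) ^ h * ∫ x : Euc n, D h x dirs * φ x

/-- The Euclidean length `|∇^h u|(x)` of the `h`-th order weak gradient. -/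
def gradLen (n : ℕ) (D : (h : ℕ) → Euc n → (Fin h → Fin n) → ℝ) (h : ℕ) (x : Euc n) : ℝ :=
  Real.sqrt (∑ d : Fin h → Fin n, (D h x d) ^ 2)

/-- The derivatives of orders `k, …, m` decay near infinity:
`|{|∇^h u| > t}| < ∞` for every `t > 0`. -/
def DecayFrom (n k m : ℕ) (D : (h : ℕ) → Euc n → (Fin h → Fin n) → ℝ) : Prop :=
  ∀ h : ℕ, k ≤ h → h ≤ m → ∀ t : ℝ, 0 < t →
    volume {x : Euc n | t < gradLen n D h x} < ⊤

/-- The Young function `F_k(t) = t^{n/(n-s+k+1)} ∫_0^t Ã(τ) τ^{-1-n/(n-s+k+1)} dτ`. -/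
def Fk (n : ℕ) (s : ℝ) (k : ℕ) (A : ℝ → ℝ≥0∞) (t : ℝ) : ℝ≥0∞ :=
  ENNReal.ofReal (t ^ ((n : ℝ) / ((n : ℝ) - s + (k : ℝ) + 1))) *
    ∫⁻ τ in Set.Ioc (0 : ℝ) t,
      youngConj A τ * ENNReal.ofReal (τ ^ (-1 - (n : ℝ) / ((n : ℝ) - s + (k : ℝ) + 1)))

/-- `ψ^k_{s,A}(r) = 1 / (r^{n-s+k} F_k⁻¹(r^{-n}))`. -/
def psiK (n : ℕ) (s : ℝ) (k : ℕ) (A : ℝ → ℝ≥0∞) (r : ℝ) : ℝ :=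
  (r ^ ((n : ℝ) - s + (k : ℝ)) * rcInv (Fk n s k A) (ENNReal.ofReal (r ^ (-(n : ℝ)))))⁻¹

/-- `ψ^{[s]}_{s,A}(r) = r^{{s}} A⁻¹(r^{-n})`. -/
def psiTop (n : ℕ) (s : ℝ) (A : ℝ → ℝ≥0∞) (r : ℝ) : ℝ :=
  r ^ (s - (⌊s⌋₊ : ℝ)) * rcInv A (ENNReal.ofReal (r ^ (-(n : ℝ))))

/-- Convergence near zero of `∫_0 (t/A(t))^{(s-(k+1))/(n-(s-(k+1)))} dt`. -/
def IntCondK (n : ℕ) (s : ℝ) (k : ℕ) (A : ℝ → ℝ≥0∞) : Prop :=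
  ∃ ε : ℝ, 0 < ε ∧
    ∫⁻ t in Set.Ioc (0 : ℝ) ε,
      (ENNReal.ofReal t / A t) ^ ((s - (k : ℝ) - 1) / ((n : ℝ) - (s - (k : ℝ) - 1))) < ⊤

/-- `P` is the projection polynomial `P^k_B[u]`: it has degree at most `k` and its
derivatives up to order `k` match, in the mean over `B`, the weak derivatives `D` of `u`. -/
def IsCampPoly (n k : ℕ) (D : (h : ℕ) → Euc n → (Fin h → Fin n) → ℝ)
    (B : Set (Euc n)) (P : MvPolynomial (Fin n) ℝ) : Prop :=
  P.totalDegree ≤ k ∧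
  ∀ h : ℕ, h ≤ k → ∀ dirs : Fin h → Fin n,
    ∫ x in B, D h x dirs =
      ∫ x in B,
        iteratedFDeriv ℝ h (fun y : Euc n => MvPolynomial.eval (fun i => y i) P) x
          (fun i => EuclideanSpace.single (dirs i) (1 : ℝ))

/-- The normalized oscillation of order `k` over the ball `B(x,r)`. -/
def oscQuotK (n k : ℕ) (φ : ℝ → ℝ) (u : Euc n → ℝ)
    (D : (h : ℕ) → Euc n → (Fin h → Fin n) → ℝ) (x : Euc n) (r : ℝ) : ℝ≥0∞ :=
  ⨅ (P : MvPolynomial (Fin n) ℝ) (_ : IsCampPoly n k D (ball x r) P),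
    ENNReal.ofReal
      ((φ ((volume (ball x r)).toReal ^ ((n : ℝ)⁻¹)) *
          (volume (ball x r)).toReal ^ ((k : ℝ) / (n : ℝ)))⁻¹ *
        ⨍ y in ball x r, |u y - MvPolynomial.eval (fun i => y i) P|)

/-- The `k`-th order Campanato seminorm `|u|_{𝓛^{k,φ}(ℝⁿ)}`. -/
def campSemK (n k : ℕ) (φ : ℝ → ℝ) (u : Euc n → ℝ)
    (D : (h : ℕ) → Euc n → (Fin h → Fin n) → ℝ) : ℝ≥0∞ :=
  ⨆ (x : Euc n) (r : ℝ) (_ : 0 < r), oscQuotK n k φ u D x r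

/-- The `k`-th order Campanato quantity restricted to balls of measure at most `r`. -/
def campSemKSmall (n k : ℕ) (φ : ℝ → ℝ) (u : Euc n → ℝ)
    (D : (h : ℕ) → Euc n → (Fin h → Fin n) → ℝ) (r : ℝ) : ℝ≥0∞ :=
  ⨆ (x : Euc n) (ρ : ℝ) (_ : 0 < ρ) (_ : volume (ball x ρ) ≤ ENNReal.ofReal r),
    oscQuotK n k φ u D x ρ

/-- The Luxemburg norm `‖f‖_{L^A(μ)}`. -/
def luxNorm {α : Type*} [MeasurableSpace α] (A : ℝ → ℝ≥0∞) (μ : Measure α)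
    (f : α → ℝ) : ℝ≥0∞ :=
  sInf (ENNReal.ofReal '' {lam : ℝ | 0 < lam ∧ ∫⁻ x, A (|f x| / lam) ∂μ ≤ 1})

/-- Iterated integral `∫_r^∞ ∫_{r_1}^∞ ⋯ g`. -/
def iterInt : ℕ → (ℝ → ℝ) → (ℝ → ℝ)
  | 0, g => g
  | j + 1, g => fun r => ∫ t in Set.Ioi r, iterInt j g t

end

lemma IsYoung.apply_mul_le {A : ℝ → ℝ≥0∞} (hA : IsYoung A) {a t : ℝ} (ha : 0 ≤ a) (ha1 : a ≤ 1)
    (ht : 0 ≤ t) : A (a * t) ≤ ENNReal.ofReal a * A t := by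
  have h := hA.2.1 t 0 a ht le_rfl ha ha1
  simpa [hA.1] using h

lemma IsYoung.exists_finite {A : ℝ → ℝ≥0∞} (hA : IsYoung A) : ∃ t, 0 < t ∧ A t ≠ ⊤ := by
  obtain ⟨t₁, t₂, h₁, h₂, h⟩ := hA.2.2.2
  by_cases h₃ : A t₁ = ⊤
  · exact ⟨t₂, h₂, fun h₄ => h (h₃.trans h₄.symm)⟩
  · exact ⟨t₁, h₁, h₃⟩

/-- A Young function cannot dominate a sublinear power. -/
lemma IsYoung.one_le_of_rpow_le {A : ℝ → ℝ≥0∞} (hA : IsYoung A) {c p : ℝ} (hc : 0 < c)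
    (h : ∀ t, 0 < t → ENNReal.ofReal (c * t ^ p) ≤ A t) : 1 ≤ p := by
  by_contra! hp
  obtain ⟨t, ht, hfin⟩ := hA.exists_finite
  set M := (A t).toReal
  have hM : A t = ENNReal.ofReal M := (ENNReal.ofReal_toReal hfin).symm
  have hM0 : 0 ≤ M := ENNReal.toReal_nonneg
  have key : ∀ a, 0 < a → a ≤ 1 → c * t ^ p ≤ a ^ (1 - p) * M := by
    intro a ha ha1
    have h1 := (h (a * t) (by positivity)).trans (hA.apply_mul_le ha.le ha1 ht.le)
    rw [hM, ← ENNReal.ofReal_mul ha.le, ENNReal.ofReal_le_ofReal_iff (by positivity),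
      Real.mul_rpow ha.le ht.le] at h1
    rw [Real.rpow_sub ha, Real.rpow_one, div_mul_eq_mul_div, le_div_iff₀ (by positivity)]
    linarith
  have hlim : Tendsto (fun a : ℝ => a ^ (1 - p) * M) (𝓝[>] 0) (𝓝 (0 ^ (1 - p) * M)) := by
    refine Tendsto.mul_const _ ?_
    exact ((Real.continuousAt_rpow_const 0 (1 - p) (Or.inr (by linarith))).tendsto).mono_left
      nhdsWithin_le_nhds
  rw [Real.zero_rpow (by linarith), zero_mul] at hlim
  have h2 : c * t ^ p ≤ 0 := by
    refine ge_of_tendsto hlim ?_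
    filter_upwards [Ioc_mem_nhdsGT (show (0 : ℝ) < 1 by norm_num)] with a ha
    exact key a ha.1 ha.2
  have : 0 < c * t ^ p := by positivity
  linarith

lemma youngConj_mono (A : ℝ → ℝ≥0∞) {x y : ℝ} (hxy : x ≤ y) :
    youngConj A x ≤ youngConj A y := by
  unfold youngConj
  gcongr

lemma ofReal_mul_le_add_youngConj (A : ℝ → ℝ≥0∞) {τ : ℝ} (hτ : 0 ≤ τ) (t : ℝ) :
    ENNReal.ofReal (τ * t) ≤ A τ + youngConj A t := by
  rw [← tsub_le_iff_left]
  exact le_iSup₂ (f := fun (τ : ℝ) (_ : 0 ≤ τ) => ENNReal.ofReal (τ * t) - A τ) τ hτ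

lemma youngConj_le_of_rpow_le {A : ℝ → ℝ≥0∞} {c p t : ℝ} (hc : 0 < c) (hp : 1 < p) (ht : 0 < t)
    (h : ∀ t, 0 < t → ENNReal.ofReal (c * t ^ p) ≤ A t) :
    youngConj A t ≤ ENNReal.ofReal ((c⁻¹) ^ (p - 1)⁻¹ * t ^ (p / (p - 1))) := by
  have hp1 : 0 < p - 1 := by linarith
  refine iSup₂_le fun τ hτ => ?_
  rcases hτ.eq_or_lt with rfl | hτ
  · simp
  by_cases hle : τ * t ≤ c * τ ^ p
  · rw [tsub_eq_zero_of_le ((ENNReal.ofReal_le_ofReal hle).trans (h τ hτ))]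
    exact zero_le
  · refine tsub_le_self.trans (ENNReal.ofReal_le_ofReal ?_)
    push Not at hle
    have h1 : τ ^ (p - 1) ≤ c⁻¹ * t := by
      rw [Real.rpow_sub hτ, Real.rpow_one, div_le_iff₀ hτ, inv_mul_eq_div, div_mul_eq_mul_div,
        le_div_iff₀ hc]
      linarith
    have h2 : τ ≤ (c⁻¹ * t) ^ (p - 1)⁻¹ := by
      rw [Real.le_rpow_inv_iff_of_pos hτ.le (by positivity) hp1]
      exact h1
    calc τ * t ≤ (c⁻¹ * t) ^ (p - 1)⁻¹ * t := by gcongr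
      _ = (c⁻¹) ^ (p - 1)⁻¹ * (t ^ (p - 1)⁻¹ * t ^ (1 : ℝ)) := by
        rw [Real.mul_rpow (by positivity) ht.le, Real.rpow_one, mul_assoc]
      _ = _ := by
        rw [← Real.rpow_add ht]
        congr 2
        field_simp
        ring

lemma rpow_le_of_youngConj_le {A : ℝ → ℝ≥0∞} {C p : ℝ} (hC : 0 < C) (hp : 1 < p)
    (h : ∀ t, 0 < t → youngConj A t ≤ ENNReal.ofReal (C * t ^ (p / (p - 1)))) :
    ∃ c, 0 < c ∧ ∀ t, 0 < t → ENNReal.ofReal (c * t ^ p) ≤ A t := by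
  have hp1 : 0 < p - 1 := by linarith
  set δ : ℝ := (2 * C)⁻¹ ^ (p - 1) with hδ
  have hδ0 : 0 < δ := by positivity
  refine ⟨δ / 2, by positivity, fun t ht => ?_⟩
  have h1 := ofReal_mul_le_add_youngConj A ht.le (δ * t ^ (p - 1))
  have h2 := h (δ * t ^ (p - 1)) (by positivity)
  have e1 : t * (δ * t ^ (p - 1)) = δ * t ^ p := by
    rw [Real.rpow_sub ht, Real.rpow_one]
    field_simp
  have e2 : C * (δ * t ^ (p - 1)) ^ (p / (p - 1)) = δ / 2 * t ^ p := by
    rw [Real.mul_rpow hδ0.le (by positivity), ← Real.rpow_mul ht.le, mul_div_cancel₀ _ hp1.ne']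
    have : p / (p - 1) = 1 + (p - 1)⁻¹ := by field_simp; ring
    rw [this, Real.rpow_add hδ0, Real.rpow_one]
    have : δ ^ (p - 1)⁻¹ = (2 * C)⁻¹ := by
      rw [hδ, ← Real.rpow_mul (by positivity), mul_inv_cancel₀ hp1.ne', Real.rpow_one]
    rw [this]
    field_simp
  rw [e1] at h1
  rw [e2] at h2
  have h3 : ENNReal.ofReal (δ * t ^ p) ≤ A t + ENNReal.ofReal (δ / 2 * t ^ p) :=
    h1.trans (by gcongr)
  rw [← tsub_le_iff_right, ← ENNReal.ofReal_sub _ (by positivity)] at h3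
  convert h3 using 2
  ring

/-- The integral growth condition on the conjugate is a pure power lower bound on `A`. -/
lemma rpow_le_iff_integral_youngConj_le {A : ℝ → ℝ≥0∞} {n s : ℝ} (hs : 1 < s) (hsn : s < n) :
    (∃ c, 0 < c ∧ ∀ t, 0 < t → ENNReal.ofReal (c * t ^ (n / s)) ≤ A t) ↔
      ∃ c : ℝ, 0 < c ∧ ∀ t : ℝ, 0 < t →
        (∫⁻ τ in Set.Ioc (0 : ℝ) t,
            youngConj A τ * ENNReal.ofReal (τ ^ (-1 - n / (n + 1 - s)))) ≤
          ENNReal.ofReal (c * t ^ (n / ((n - s) * (n + 1 - s)))) := by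
  have hn : 0 < n := by linarith
  have hs0 : 0 < s := by linarith
  have hp : 1 < n / s := (one_lt_div hs0).2 hsn
  have hns : 0 < n - s := by linarith
  have hns1 : 0 < n + 1 - s := by linarith
  have hconj : n / s / (n / s - 1) = n / (n - s) := by field_simp
  set α := n / ((n - s) * (n + 1 - s)) with hα
  set q := n / (n + 1 - s) with hq
  have hα0 : 0 < α := by positivity
  have hq0 : 0 < q := by positivity
  have hsum : n / (n - s) = α + q := by
    rw [hα, hq]
    field_simp
    ring
  constructor
  · rintro ⟨c, hc, h⟩
    set K := (c⁻¹) ^ (n / s - 1)⁻¹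
    have hK : 0 < K := by positivity
    refine ⟨K / α, by positivity, fun t ht => ?_⟩
    have hint : IntervalIntegrable (fun τ : ℝ => K * τ ^ (α - 1)) volume 0 t :=
      (intervalIntegral.intervalIntegrable_rpow' (by linarith)).const_mul K
    calc (∫⁻ τ in Set.Ioc (0 : ℝ) t, youngConj A τ * ENNReal.ofReal (τ ^ (-1 - q)))
        ≤ ∫⁻ τ in Set.Ioc (0 : ℝ) t, ENNReal.ofReal (K * τ ^ (α - 1)) := by
          refine setLIntegral_mono' measurableSet_Ioc fun τ hτ => ?_
          have h1 := youngConj_le_of_rpow_le hc hp hτ.1 h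
          rw [hconj] at h1
          have hτ0 := hτ.1
          calc _ ≤ ENNReal.ofReal (K * τ ^ (n / (n - s))) * ENNReal.ofReal (τ ^ (-1 - q)) := by
                gcongr
            _ = _ := by
              rw [← ENNReal.ofReal_mul (by positivity), mul_assoc, ← Real.rpow_add hτ0, hsum]
              congr 3
              ring
      _ = ENNReal.ofReal (∫ τ in Set.Ioc (0 : ℝ) t, K * τ ^ (α - 1)) := by
          rw [ofReal_integral_eq_lintegral_ofReal]
          · exact (intervalIntegrable_iff_integrableOn_Ioc_of_le ht.le).1 hint
          · filter_upwards [ae_restrict_mem measurableSet_Ioc] with τ hτ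
            have := hτ.1
            positivity
      _ = ENNReal.ofReal (K / α * t ^ α) := by
          rw [← intervalIntegral.integral_of_le ht.le, intervalIntegral.integral_const_mul,
            integral_rpow (Or.inl (by linarith)), sub_add_cancel, Real.zero_rpow hα0.ne']
          congr 1
          ring
  · rintro ⟨c, hc, h⟩
    refine rpow_le_of_youngConj_le (C := 2 ^ (α + 1 + q) * c) (by positivity) hp fun t ht => ?_
    rw [hconj]
    have h1 : youngConj A t * ENNReal.ofReal ((2 * t) ^ (-1 - q)) * ENNReal.ofReal t ≤
        ENNReal.ofReal (c * (2 * t) ^ α) := by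
      refine le_trans ?_ (h (2 * t) (by positivity))
      calc _ = ∫⁻ τ in Set.Ioc t (2 * t),
            youngConj A t * ENNReal.ofReal ((2 * t) ^ (-1 - q)) := by
            rw [setLIntegral_const, Real.volume_Ioc]
            congr 2
            ring
        _ ≤ ∫⁻ τ in Set.Ioc t (2 * t), youngConj A τ * ENNReal.ofReal (τ ^ (-1 - q)) := by
            refine setLIntegral_mono' measurableSet_Ioc fun τ hτ => ?_
            have hτ0 : 0 < τ := ht.trans hτ.1
            gcongr ?_ * ENNReal.ofReal ?_
            · exact youngConj_mono A hτ.1.le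
            · exact Real.rpow_le_rpow_of_nonpos hτ0 hτ.2 (by linarith)
        _ ≤ _ := lintegral_mono_set (Ioc_subset_Ioc_left ht.le)
    have h2 : 0 < (2 * t) ^ (-1 - q) * t := by positivity
    rw [mul_assoc, ← ENNReal.ofReal_mul (by positivity)] at h1
    have h3 : youngConj A t ≤ ENNReal.ofReal (c * (2 * t) ^ α) /
        ENNReal.ofReal ((2 * t) ^ (-1 - q) * t) := by
      rw [ENNReal.le_div_iff_mul_le]
      · exact h1
      · left
        simpa using h2
      · left
        exact ENNReal.ofReal_ne_top
    refine h3.trans (le_of_eq ?_)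
    rw [← ENNReal.ofReal_div_of_pos h2]
    congr 1
    rw [div_eq_iff h2.ne', hsum, Real.mul_rpow zero_le_two ht.le, Real.mul_rpow zero_le_two ht.le]
    have e1 : (2 : ℝ) ^ (α + 1 + q) = 2 ^ α * (2 ^ (-1 - q))⁻¹ := by
      rw [← Real.rpow_neg zero_le_two, ← Real.rpow_add zero_lt_two]
      congr 1
      ring
    have e2 : t ^ (α + q) = t ^ α * (t ^ (-1 - q))⁻¹ * t⁻¹ := by
      rw [← Real.rpow_neg ht.le, ← Real.rpow_neg_one, ← Real.rpow_add ht, ← Real.rpow_add ht]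
      congr 1
      ring
    rw [e1, e2]
    have := Real.rpow_pos_of_pos ht (-1 - q)
    have := Real.rpow_pos_of_pos (zero_lt_two' ℝ) (-1 - q)
    field_simp

lemma volume_real_ball {n : ℕ} (x : Euc n) {r : ℝ} (hr : 0 < r) :
    volume.real (ball x r) = r ^ n * volume.real (ball (0 : Euc n) 1) := by
  rw [Measure.real, Measure.addHaar_ball_of_pos _ _ hr, ENNReal.toReal_mul,
    ENNReal.toReal_ofReal (by positivity), finrank_euclideanSpace_fin, Measure.real]

lemma volume_real_ball_pos {n : ℕ} (x : Euc n) {r : ℝ} (hr : 0 < r) :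
    0 < volume.real (ball x r) :=
  ENNReal.toReal_pos (measure_ball_pos _ _ hr).ne' measure_ball_lt_top.ne

lemma integrableOn_ball_of_locallyIntegrable {n : ℕ} {f : Euc n → ℝ}
    (hf : LocallyIntegrable f volume) (x : Euc n) (r : ℝ) : IntegrableOn f (ball x r) :=
  (hf.integrableOn_isCompact (isCompact_closedBall x r)).mono_set ball_subset_closedBall

lemma abs_setAverage_sub_le {n : ℕ} {f : Euc n → ℝ} (hf : LocallyIntegrable f volume)
    (x : Euc n) {r : ℝ} (hr : 0 < r) (c : ℝ) :
    |(⨍ y in ball x r, f y) - c| ≤ ⨍ y in ball x r, |f y - c| := by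
  have hV := volume_real_ball_pos x hr
  have hf' := integrableOn_ball_of_locallyIntegrable hf x r
  have h1 : (⨍ y in ball x r, f y) - c = ⨍ y in ball x r, (f y - c) := by
    rw [setAverage_eq, setAverage_eq, integral_sub hf' (integrableOn_const measure_ball_lt_top.ne),
      setIntegral_const, smul_sub, smul_smul, inv_mul_cancel₀ hV.ne', one_smul]
  rw [h1, setAverage_eq, setAverage_eq, smul_eq_mul, smul_eq_mul, abs_mul,
    abs_of_pos (inv_pos.2 hV)]
  gcongr
  exact abs_integral_le_integral_abs

lemma setAverage_ball_le_two_pow_mul {n : ℕ} {g : Euc n → ℝ} (hg : LocallyIntegrable g volume)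
    (hg0 : ∀ y, 0 ≤ g y) (x : Euc n) {r : ℝ} (hr : 0 < r) :
    ⨍ y in ball x r, g y ≤ 2 ^ n * ⨍ y in ball x (2 * r), g y := by
  have hV := volume_real_ball_pos x hr
  have hω := volume_real_ball_pos (0 : Euc n) one_pos
  have h1 : ∫ y in ball x r, g y ≤ ∫ y in ball x (2 * r), g y :=
    setIntegral_mono_set (integrableOn_ball_of_locallyIntegrable hg x _)
      (Eventually.of_forall hg0) (ball_subset_ball (by linarith)).eventuallyLE
  rw [setAverage_eq, setAverage_eq, volume_real_ball x (by positivity : 0 < 2 * r),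
    volume_real_ball x hr, smul_eq_mul, smul_eq_mul]
  calc _ ≤ (r ^ n * volume.real (ball (0 : Euc n) 1))⁻¹ * ∫ y in ball x (2 * r), g y := by gcongr
    _ = _ := by
      rw [mul_pow]
      field_simp

/-- The mean of a function vanishing at infinity in the sense of level sets is controlled by its
mean oscillation on large balls. -/
lemma abs_setAverage_le_of_volume_le {n : ℕ} {f : Euc n → ℝ} (hf : LocallyIntegrable f volume)
    (x : Euc n) {r ε : ℝ} (hr : 0 < r)
    (hS : 2 * volume {y | ε < |f y|} ≤ volume (ball x r)) :
    |⨍ y in ball x r, f y| ≤ ε + 2 * ⨍ y in ball x r, |f y - ⨍ z in ball x r, f z| := by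
  set a := ⨍ z in ball x r, f z
  set B := ball x r
  have hV := volume_real_ball_pos x hr
  have hint : IntegrableOn (fun y => |f y - a|) B :=
    ((integrableOn_ball_of_locallyIntegrable hf x r).sub
      (integrableOn_const measure_ball_lt_top.ne)).abs
  have hO : 0 ≤ ⨍ y in B, |f y - a| := by
    rw [setAverage_eq]
    exact smul_nonneg (inv_nonneg.2 hV.le) (integral_nonneg fun _ => abs_nonneg _)
  by_contra! hlt
  have hpos : 0 < |a| - ε := by linarith
  have hmk := mul_meas_ge_le_integral_of_nonneg (μ := volume.restrict B)
    (Eventually.of_forall fun y => abs_nonneg (f y - a)) hint (|a| - ε)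
  set T := {y | |a| - ε ≤ |f y - a|}
  set S := {y | ε < |f y|}
  have hcov : (univ : Set (Euc n)) ⊆ S ∪ T := by
    intro y _
    by_cases hy : ε < |f y|
    · exact Or.inl hy
    · right
      have := abs_sub_abs_le_abs_sub a (f y)
      rw [abs_sub_comm] at this
      simp only [T, mem_ofPred_eq]
      linarith [not_lt.1 hy]
  have h1 : volume B ≤ volume S + volume.restrict B T := by
    calc volume B = volume.restrict B univ := by simp
      _ ≤ volume.restrict B S + volume.restrict B T :=
        (measure_mono hcov).trans (measure_union_le _ _)
      _ ≤ _ := by gcongr; exact Measure.restrict_le_self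
  have hBfin : volume B ≠ ⊤ := measure_ball_lt_top.ne
  have hTfin : volume.restrict B T ≠ ⊤ :=
    ((measure_mono (subset_univ T)).trans_lt (by simpa using measure_ball_lt_top)).ne
  have hSfin : volume S ≠ ⊤ := by
    intro h
    rw [h] at hS
    exact hBfin (top_le_iff.1 (by simpa using hS))
  have h2 : volume.real B ≤ volume.real S + (volume.restrict B).real T := by
    rw [Measure.real, Measure.real, Measure.real, ← ENNReal.toReal_add hSfin hTfin]
    exact ENNReal.toReal_mono (by finiteness) h1
  have h3 : 2 * volume.real S ≤ volume.real B := by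
    have := ENNReal.toReal_mono hBfin hS
    simpa [Measure.real] using this
  rw [setAverage_eq, smul_eq_mul] at hlt
  have h4 : 2 * ∫ y in B, |f y - a| < (|a| - ε) * volume.real B := by
    have : 2 * ((volume.real B)⁻¹ * ∫ y in B, |f y - a|) < |a| - ε := by linarith
    rw [mul_left_comm, inv_mul_eq_div, div_lt_iff₀ hV] at this
    linarith
  nlinarith

/-- Campanato-type decay of the mean oscillation, together with vanishing at infinity, gives
Morrey-type decay of the means. -/
lemma setAverage_abs_le_of_oscillation {n : ℕ} (hn : 0 < n) {f : Euc n → ℝ}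
    (hf : LocallyIntegrable f volume) (hdec : ∀ t, 0 < t → volume {x | t < |f x|} < ⊤)
    {K : ℝ} (hK : 0 ≤ K) {k : ℕ} (hk : k ≠ 0)
    (hosc : ∀ x r, 0 < r →
      ⨍ y in ball x r, |f y - ⨍ z in ball x r, f z| ≤ K * (r ^ k)⁻¹)
    (x : Euc n) {r : ℝ} (hr : 0 < r) :
    ⨍ y in ball x r, |f y| ≤ (2 ^ n + 3) * K * (r ^ k)⁻¹ := by
  have hω := volume_real_ball_pos (0 : Euc n) one_pos
  have hdbl : ∀ ρ, 0 < ρ → |(⨍ y in ball x ρ, f y) - ⨍ y in ball x (2 * ρ), f y| ≤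
      2 ^ n * (K * ((2 * ρ) ^ k)⁻¹) := by
    intro ρ hρ
    refine (abs_setAverage_sub_le hf x hρ _).trans ?_
    refine (setAverage_ball_le_two_pow_mul ?_ (fun _ => abs_nonneg _) x hρ).trans ?_
    · have : LocallyIntegrable (fun y => f y - ⨍ y in ball x (2 * ρ), f y) volume :=
        hf.sub (locallyIntegrable_const _)
      exact this.mono this.aestronglyMeasurable.norm (Eventually.of_forall fun y => by simp)
    · gcongr
      exact hosc x _ (by positivity)
  have htel : ∀ J : ℕ, |(⨍ y in ball x r, f y) - ⨍ y in ball x (2 ^ J * r), f y| ≤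
      2 ^ n * K * (r ^ k)⁻¹ * (1 - (2 ^ J)⁻¹) := by
    intro J
    induction J with
    | zero => simp
    | succ J ih =>
      have h1 := hdbl (2 ^ J * r) (by positivity)
      have h2 : ((2 * (2 ^ J * r)) ^ k)⁻¹ ≤ (2 * 2 ^ J)⁻¹ * (r ^ k)⁻¹ := by
        rw [← mul_inv, ← mul_assoc, mul_pow]
        gcongr
        refine le_self_pow₀ ?_ hk
        have : (1 : ℝ) ≤ 2 ^ J := one_le_pow₀ one_le_two
        linarith
      have h3 : 2 ^ n * (K * ((2 * (2 ^ J * r)) ^ k)⁻¹) ≤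
          2 ^ n * (K * ((2 * 2 ^ J)⁻¹ * (r ^ k)⁻¹)) := by gcongr
      have h4 := abs_sub_le (⨍ y in ball x r, f y) (⨍ y in ball x (2 ^ J * r), f y)
        (⨍ y in ball x (2 ^ (J + 1) * r), f y)
      have e : (2 : ℝ) ^ (J + 1) * r = 2 * (2 ^ J * r) := by ring
      rw [e] at h4 ⊢
      have e2 : 2 ^ n * K * (r ^ k)⁻¹ * (1 - (2 ^ (J + 1))⁻¹) =
          2 ^ n * K * (r ^ k)⁻¹ * (1 - (2 ^ J)⁻¹) +
          2 ^ n * (K * ((2 * 2 ^ J)⁻¹ * (r ^ k)⁻¹)) := by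
        field_simp
        ring
      linarith
  have hfar : ∀ ε, 0 < ε → |⨍ y in ball x r, f y| ≤ 2 ^ n * K * (r ^ k)⁻¹ +
      (ε + 2 * (K * (r ^ k)⁻¹)) := by
    intro ε hε
    set M := (volume {y | ε < |f y|}).toReal
    obtain ⟨J, hJ⟩ : ∃ J : ℕ,
        2 * M / (r ^ n * volume.real (ball (0 : Euc n) 1)) ≤ (2 : ℝ) ^ J := by
      obtain ⟨J, hJ⟩ := pow_unbounded_of_one_lt
        (2 * M / (r ^ n * volume.real (ball (0 : Euc n) 1))) one_lt_two
      exact ⟨J, hJ.le⟩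
    have h2J : (1 : ℝ) ≤ 2 ^ J := one_le_pow₀ one_le_two
    have hrJ : 0 < 2 ^ J * r := by positivity
    have hball := volume_real_ball x hrJ
    rw [Measure.real] at hball
    have hvol : 2 * volume {y | ε < |f y|} ≤ volume (ball x (2 ^ J * r)) := by
      rw [← ENNReal.toReal_le_toReal (by finiteness [hdec ε hε]) measure_ball_lt_top.ne,
        hball, ENNReal.toReal_mul]
      rw [div_le_iff₀ (by positivity)] at hJ
      have : (2 : ℝ) ^ J ≤ (2 ^ J) ^ n := le_self_pow₀ h2J hn.ne'
      calc _ ≤ 2 ^ J * (r ^ n * volume.real (ball (0 : Euc n) 1)) := by simpa using hJ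
        _ ≤ (2 ^ J) ^ n * (r ^ n * volume.real (ball (0 : Euc n) 1)) := by gcongr
        _ = _ := by rw [mul_pow]; ring
    have h1 := abs_setAverage_le_of_volume_le hf x hrJ hvol
    have h2 := hosc x _ hrJ
    have h3 : ((2 ^ J * r) ^ k)⁻¹ ≤ (r ^ k)⁻¹ := by
      gcongr
      nlinarith
    have h3' : K * ((2 ^ J * r) ^ k)⁻¹ ≤ K * (r ^ k)⁻¹ := by gcongr
    have h4 := htel J
    have h5 : 2 ^ n * K * (r ^ k)⁻¹ * (1 - (2 ^ J)⁻¹) ≤ 2 ^ n * K * (r ^ k)⁻¹ := by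
      refine mul_le_of_le_one_right (by positivity) ?_
      simp
    have h6 := abs_sub_abs_le_abs_sub (⨍ y in ball x r, f y) (⨍ y in ball x (2 ^ J * r), f y)
    linarith
  have hmean : |⨍ y in ball x r, f y| ≤ (2 ^ n + 2) * K * (r ^ k)⁻¹ := by
    refine le_of_forall_pos_le_add fun ε hε => (hfar ε hε).trans (le_of_eq ?_)
    ring
  have hV := volume_real_ball_pos x hr
  have hf' := integrableOn_ball_of_locallyIntegrable hf x r
  set a := ⨍ z in ball x r, f z
  have hsub : ⨍ y in ball x r, |f y| ≤ (⨍ y in ball x r, |f y - a|) + |a| := by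
    rw [setAverage_eq, setAverage_eq, smul_eq_mul, smul_eq_mul]
    have hc : IntegrableOn (fun _ => |a|) (ball x r) (volume : Measure (Euc n)) :=
      integrableOn_const measure_ball_lt_top.ne
    have hs : IntegrableOn (fun y => |f y - a|) (ball x r) :=
      (hf'.sub (integrableOn_const measure_ball_lt_top.ne)).abs
    have : ∫ y in ball x r, |f y| ≤ (∫ y in ball x r, |f y - a|) + volume.real (ball x r) * |a| := by
      rw [← smul_eq_mul (volume.real _), ← setIntegral_const, ← integral_add hs hc]
      refine integral_mono hf'.abs (hs.add hc) fun y => ?_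
      have := abs_sub_abs_le_abs_sub (f y) a
      simp only
      linarith
    rw [inv_mul_eq_div, inv_mul_eq_div, div_add' _ _ _ hV.ne']
    gcongr
    linarith
  have := hosc x r hr
  have e : (2 ^ n + 3) * K * (r ^ k)⁻¹ = K * (r ^ k)⁻¹ + (2 ^ n + 2) * K * (r ^ k)⁻¹ := by ring
  linarith

lemma setLIntegral_ball_comp_add_le {n : ℕ} (F : Euc n → ℝ≥0∞) (a v : Euc n) {ρ ρ' : ℝ}
    (h : ρ + ‖v‖ ≤ ρ') : ∫⁻ x in ball a ρ, F (x + v) ≤ ∫⁻ x in ball a ρ', F x := by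
  rw [← lintegral_indicator measurableSet_ball, ← lintegral_indicator measurableSet_ball,
    ← lintegral_add_right_eq_self ((ball a ρ').indicator F) v]
  refine lintegral_mono fun x => ?_
  by_cases hx : x ∈ ball a ρ
  · have hxv : x + v ∈ ball a ρ' := by
      rw [mem_ball, dist_eq_norm] at hx ⊢
      have : x + v - a = (x - a) + v := by abel
      rw [this]
      linarith [norm_add_le (x - a) v]
    rw [indicator_of_mem hx, indicator_of_mem hxv]
  · rw [indicator_of_notMem hx]
    exact zero_le

lemma enorm_clm_apply_le_sum {n : ℕ} (L : Euc n →L[ℝ] ℝ) (h : Euc n) :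
    ‖L h‖ₑ ≤ ‖h‖ₑ * ∑ i, ‖L (EuclideanSpace.single i 1)‖ₑ := by
  have h1 : L h = ∑ i, h i * L (EuclideanSpace.single i 1) := by
    conv_lhs => rw [← (EuclideanSpace.basisFun (Fin n) ℝ).sum_repr h]
    simp
  rw [h1, Finset.mul_sum]
  refine (enorm_sum_le _ _).trans (Finset.sum_le_sum fun i _ => ?_)
  rw [enorm_mul]
  gcongr
  exact enorm_le_iff_norm_le.2 (PiLp.norm_apply_le h i)

lemma enorm_sub_le_lintegral_segment {n : ℕ} {f : Euc n → ℝ} (hf : ContDiff ℝ 1 f)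
    (x h : Euc n) :
    ‖f (x + h) - f x‖ₑ ≤ ‖h‖ₑ * ∫⁻ t in Ioc (0 : ℝ) 1,
      ∑ i, ‖fderiv ℝ f (x + t • h) (EuclideanSpace.single i 1)‖ₑ := by
  have hd : ∀ t : ℝ, HasDerivAt (fun t : ℝ => f (x + t • h)) (fderiv ℝ f (x + t • h) h) t := by
    intro t
    have h1 : HasDerivAt (fun t : ℝ => x + t • h) h t := by
      simpa using ((hasDerivAt_id t).smul_const h).const_add x
    exact (hf.differentiable one_ne_zero _).hasFDerivAt.comp_hasDerivAt t h1
  have hc : Continuous fun t : ℝ => fderiv ℝ f (x + t • h) h := by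
    have := hf.continuous_fderiv one_ne_zero
    fun_prop
  have h2 := intervalIntegral.integral_eq_sub_of_hasDerivAt (a := 0) (b := 1)
    (fun t _ => hd t) (hc.intervalIntegrable 0 1)
  simp only [one_smul, zero_smul, add_zero] at h2
  rw [← h2, intervalIntegral.integral_of_le zero_le_one, ← lintegral_const_mul']
  · exact (enorm_integral_le_lintegral_enorm _).trans
      (lintegral_mono fun t => enorm_clm_apply_le_sum _ h)
  · exact enorm_ne_top

/-- A double-integral Poincaré inequality on balls for `C¹` functions. -/
lemma ContDiff.lintegral_enorm_sub_le {n : ℕ} {f : Euc n → ℝ} (hf : ContDiff ℝ 1 f)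
    (a : Euc n) (r : ℝ) :
    ∫⁻ x in ball a r, ∫⁻ y in ball a r, ‖f x - f y‖ₑ ≤
      ENNReal.ofReal (2 * r) * volume (ball (0 : Euc n) (2 * r)) *
        ∫⁻ z in ball a (3 * r), ∑ i, ‖fderiv ℝ f z (EuclideanSpace.single i 1)‖ₑ := by
  set G : Euc n → ℝ≥0∞ := fun z => ∑ i, ‖fderiv ℝ f z (EuclideanSpace.single i 1)‖ₑ with hG
  have hGc : Continuous G := by
    have := hf.continuous_fderiv one_ne_zero
    fun_prop
  have hinner : ∀ x ∈ ball a r, ∫⁻ y in ball a r, ‖f x - f y‖ₑ ≤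
      ∫⁻ h in ball (0 : Euc n) (2 * r),
        ENNReal.ofReal (2 * r) * ∫⁻ t in Ioc (0 : ℝ) 1, G (x + t • h) := by
    intro x hx
    rw [← lintegral_indicator measurableSet_ball, ← lintegral_indicator measurableSet_ball,
      ← lintegral_add_left_eq_self _ x]
    refine lintegral_mono fun h => ?_
    by_cases hh : x + h ∈ ball a r
    · have hh2 : h ∈ ball (0 : Euc n) (2 * r) := by
        rw [mem_ball, dist_eq_norm] at hx hh
        rw [mem_ball_zero_iff]
        have : h = (x + h - a) - (x - a) := by abel
        rw [this]
        linarith [norm_sub_le (x + h - a) (x - a)]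
      rw [indicator_of_mem hh, indicator_of_mem hh2, ← neg_sub, enorm_neg]
      refine (enorm_sub_le_lintegral_segment hf x h).trans ?_
      gcongr
      rw [← ofReal_norm]
      exact ENNReal.ofReal_le_ofReal (mem_ball_zero_iff.1 hh2).le
    · rw [indicator_of_notMem hh]
      exact zero_le
  calc ∫⁻ x in ball a r, ∫⁻ y in ball a r, ‖f x - f y‖ₑ
      ≤ ∫⁻ x in ball a r, ∫⁻ h in ball (0 : Euc n) (2 * r),
        ENNReal.ofReal (2 * r) * ∫⁻ t in Ioc (0 : ℝ) 1, G (x + t • h) :=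
        setLIntegral_mono' measurableSet_ball hinner
    _ = ∫⁻ h in ball (0 : Euc n) (2 * r), ∫⁻ x in ball a r,
        ENNReal.ofReal (2 * r) * ∫⁻ t in Ioc (0 : ℝ) 1, G (x + t • h) := by
        refine lintegral_lintegral_swap (Measurable.aemeasurable ?_)
        refine Measurable.const_mul ?_ _
        refine Measurable.lintegral_prod_right'
          (f := fun p : (Euc n × Euc n) × ℝ => G (p.1.1 + p.2 • p.1.2)) ?_
        exact (hGc.comp (by fun_prop)).measurable
    _ = ∫⁻ h in ball (0 : Euc n) (2 * r), ENNReal.ofReal (2 * r) *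
        ∫⁻ t in Ioc (0 : ℝ) 1, ∫⁻ x in ball a r, G (x + t • h) := by
        refine lintegral_congr fun h => ?_
        rw [lintegral_const_mul' _ _ ENNReal.ofReal_ne_top, lintegral_lintegral_swap]
        exact (hGc.comp (g := G) (by fun_prop :
          Continuous fun p : Euc n × ℝ => p.1 + p.2 • h)).measurable.aemeasurable
    _ ≤ ∫⁻ h in ball (0 : Euc n) (2 * r), ENNReal.ofReal (2 * r) *
        ∫⁻ z in ball a (3 * r), G z := by
        refine setLIntegral_mono' measurableSet_ball fun h hh => ?_
        gcongr
        calc ∫⁻ t in Ioc (0 : ℝ) 1, ∫⁻ x in ball a r, G (x + t • h)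
            ≤ ∫⁻ t in Ioc (0 : ℝ) 1, ∫⁻ z in ball a (3 * r), G z := by
              refine setLIntegral_mono' measurableSet_Ioc fun t ht => ?_
              refine setLIntegral_ball_comp_add_le G a (t • h) ?_
              rw [norm_smul, Real.norm_of_nonneg ht.1.le]
              have := mem_ball_zero_iff.1 hh
              nlinarith [norm_nonneg h, ht.2]
          _ = _ := by simp
    _ = _ := by
        rw [setLIntegral_const]
        ring

lemma lintegral_enorm_convolution_le {n : ℕ} (φ : ContDiffBump (0 : Euc n)) {g : Euc n → ℝ}
    (hg : LocallyIntegrable g volume) (a : Euc n) {ρ ρ' : ℝ} (h : ρ + φ.rOut ≤ ρ') :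
    ∫⁻ x in ball a ρ, ‖convolution (φ.normed volume) g (ContinuousLinearMap.lsmul ℝ ℝ) volume x‖ₑ ≤
      ∫⁻ x in ball a ρ', ‖g x‖ₑ := by
  set ψ := φ.normed volume
  calc ∫⁻ x in ball a ρ, ‖convolution ψ g (ContinuousLinearMap.lsmul ℝ ℝ) volume x‖ₑ
      ≤ ∫⁻ x in ball a ρ, ∫⁻ t, ‖ψ t * g (x - t)‖ₑ :=
        lintegral_mono fun x => enorm_integral_le_lintegral_enorm _
    _ = ∫⁻ t, ∫⁻ x in ball a ρ, ‖ψ t * g (x - t)‖ₑ := by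
        refine lintegral_lintegral_swap ?_
        have h1 := AEStronglyMeasurable.convolution_integrand (μ := (volume : Measure (Euc n)))
          (ν := (volume : Measure (Euc n))) (ContinuousLinearMap.lsmul ℝ ℝ)
          (φ.continuous_normed (μ := volume)).aestronglyMeasurable hg.aestronglyMeasurable
        exact (h1.mono_ac (Measure.AbsolutelyContinuous.prod
          Measure.restrict_le_self.absolutelyContinuous Measure.AbsolutelyContinuous.rfl)).enorm
    _ ≤ ∫⁻ t, ‖ψ t‖ₑ * ∫⁻ x in ball a ρ', ‖g x‖ₑ := by
        refine lintegral_mono fun t => ?_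
        simp only [enorm_mul]
        rw [lintegral_const_mul' _ _ enorm_ne_top]
        by_cases ht : t ∈ ball (0 : Euc n) φ.rOut
        · refine mul_le_mul' le_rfl ?_
          simp only [sub_eq_add_neg]
          refine setLIntegral_ball_comp_add_le (fun x => ‖g x‖ₑ) a (-t) ?_
          rw [norm_neg]
          linarith [mem_ball_zero_iff.1 ht]
        · have : ψ t = 0 := by
            rw [← Function.notMem_support, φ.support_normed_eq]
            exact ht
          simp [this]
    _ = (∫⁻ t, ‖ψ t‖ₑ) * ∫⁻ x in ball a ρ', ‖g x‖ₑ :=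
        lintegral_mul_const _ (φ.continuous_normed (μ := volume)).measurable.enorm
    _ = _ := by
        have h1 : ∫⁻ t, ‖ψ t‖ₑ = 1 := by
          have h2 := ofReal_integral_eq_lintegral_ofReal (φ.integrable_normed (μ := volume))
            (Eventually.of_forall φ.nonneg_normed)
          rw [φ.integral_normed, ENNReal.ofReal_one] at h2
          rw [h2]
          exact lintegral_congr fun t => Real.enorm_of_nonneg (φ.nonneg_normed t)
        rw [h1, one_mul]

/-- `g` is the weak derivative of `f` in the direction `e`. -/
def IsWeakDeriv {n : ℕ} (e : Euc n) (f g : Euc n → ℝ) : Prop :=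
  ∀ φ : Euc n → ℝ, ContDiff ℝ (⊤ : ℕ∞) φ → HasCompactSupport φ →
    ∫ x, f x * fderiv ℝ φ x e = -∫ x, g x * φ x

lemma IsWeakDeriv.fderiv_convolution {n : ℕ} {e : Euc n} {f g : Euc n → ℝ}
    (h : IsWeakDeriv e f g) (hf : LocallyIntegrable f volume) (φ : ContDiffBump (0 : Euc n))
    (x : Euc n) :
    fderiv ℝ (convolution (φ.normed volume) f (ContinuousLinearMap.lsmul ℝ ℝ) volume) x e =
      convolution (φ.normed volume) g (ContinuousLinearMap.lsmul ℝ ℝ) volume x := by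
  set ψ := φ.normed volume
  have hψc : HasCompactSupport ψ := φ.hasCompactSupport_normed
  have hψ : ContDiff ℝ (⊤ : ℕ∞) ψ := φ.contDiff_normed
  have hψ1 : ContDiff ℝ 1 ψ := φ.contDiff_normed
  have hflip : ∀ u : Euc n → ℝ, convolution ψ u (ContinuousLinearMap.lsmul ℝ ℝ) volume =
      convolution u ψ (ContinuousLinearMap.lsmul ℝ ℝ).flip volume := fun u =>
    (convolution_flip _).symm
  rw [hflip, hflip, (hψc.hasFDerivAt_convolution_right _ hf hψ1 x).fderiv,
    convolution_precompR_apply _ hf (hψc.fderiv ℝ) (hψ1.continuous_fderiv one_ne_zero)]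
  simp only [convolution_def, ContinuousLinearMap.flip_apply, ContinuousLinearMap.lsmul_apply,
    smul_eq_mul]
  have hd : ∀ t, fderiv ℝ (fun t => ψ (x - t)) t e = -fderiv ℝ ψ (x - t) e := by
    intro t
    have h2 : HasFDerivAt (fun t => x - t) (-ContinuousLinearMap.id ℝ (Euc n)) t :=
      (hasFDerivAt_id t).const_sub x
    have h3 := ((hψ1.differentiable one_ne_zero (x - t)).hasFDerivAt.comp t h2).fderiv
    simp only [Function.comp_def] at h3
    simp [h3]
  have h1 := h (fun t => ψ (x - t)) (hψ.comp (contDiff_const.sub contDiff_id))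
    (hψc.comp_homeomorph (Homeomorph.subLeft x))
  simp only [hd, mul_neg, integral_neg, neg_inj] at h1
  simpa only [mul_comm] using h1

/-- A double-integral Poincaré inequality for weakly differentiable functions. -/
lemma lintegral_enorm_sub_le_of_isWeakDeriv {n : ℕ} {f : Euc n → ℝ} {g : Fin n → Euc n → ℝ}
    (hf : LocallyIntegrable f volume) (hg : ∀ i, LocallyIntegrable (g i) volume)
    (h : ∀ i, IsWeakDeriv (EuclideanSpace.single i 1) f (g i)) (a : Euc n) {r : ℝ} (hr : 0 < r) :
    ∫⁻ x in ball a r, ∫⁻ y in ball a r, ‖f x - f y‖ₑ ≤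
      ENNReal.ofReal (2 * r) * volume (ball (0 : Euc n) (2 * r)) *
        ∑ i, ∫⁻ z in ball a (4 * r), ‖g i z‖ₑ := by
  let φ : ℕ → ContDiffBump (0 : Euc n) := fun k =>
    ⟨r / 2 * (1 / (k + 1)), r * (1 / (k + 1)), by positivity, by
      have : (0 : ℝ) < 1 / (k + 1) := by positivity
      nlinarith⟩
  have hφlim : Tendsto (fun k => (φ k).rOut) atTop (𝓝 0) := by
    change Tendsto (fun k : ℕ => r * (1 / ((k : ℝ) + 1))) atTop (𝓝 0)
    simpa using (tendsto_one_div_add_atTop_nhds_zero_nat (𝕜 := ℝ)).const_mul r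
  have hφr : ∀ k, (φ k).rOut ≤ r := by
    intro k
    refine mul_le_of_le_one_right hr.le ?_
    rw [div_le_one (by positivity)]
    have : (0 : ℝ) ≤ k := by positivity
    linarith
  set F : ℕ → Euc n → ℝ := fun k =>
    convolution ((φ k).normed volume) f (ContinuousLinearMap.lsmul ℝ ℝ) volume with hF
  have hFc : ∀ k, ContDiff ℝ 1 (F k) := fun k =>
    (φ k).hasCompactSupport_normed.contDiff_convolution_left (n := 1) _ (φ k).contDiff_normed hf
  have hae : ∀ᵐ x, Tendsto (fun k => F k x) atTop (𝓝 (f x)) :=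
    ContDiffBump.ae_convolution_tendsto_right_of_locallyIntegrable (K := 2) hφlim
      (Eventually.of_forall fun k => le_of_eq (by simp only [φ]; ring)) hf
  have hcont : ∀ k, Continuous fun p : Euc n × Euc n => ‖F k p.1 - F k p.2‖ₑ := fun k => by
    have := (hFc k).continuous
    fun_prop
  have hbound : ∀ k, ∫⁻ x in ball a r, ∫⁻ y in ball a r, ‖F k x - F k y‖ₑ ≤
      ENNReal.ofReal (2 * r) * volume (ball (0 : Euc n) (2 * r)) *
        ∑ i, ∫⁻ z in ball a (4 * r), ‖g i z‖ₑ := by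
    intro k
    refine ((hFc k).lintegral_enorm_sub_le a r).trans ?_
    refine mul_le_mul' le_rfl ?_
    rw [lintegral_finsetSum]
    · refine Finset.sum_le_sum fun i _ => ?_
      simp only [hF, (h i).fderiv_convolution hf (φ k)]
      exact lintegral_enorm_convolution_le (φ k) (hg i) a (by linarith [hφr k])
    · intro i _
      have := (hFc k).continuous_fderiv one_ne_zero
      exact Continuous.measurable (by fun_prop)
  have haer := ae_restrict_of_ae (s := ball a r) hae
  calc ∫⁻ x in ball a r, ∫⁻ y in ball a r, ‖f x - f y‖ₑ
      ≤ ∫⁻ x in ball a r, liminf (fun k => ∫⁻ y in ball a r, ‖F k x - F k y‖ₑ) atTop := by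
        refine lintegral_mono_ae ?_
        filter_upwards [haer] with x hx
        calc ∫⁻ y in ball a r, ‖f x - f y‖ₑ
            = ∫⁻ y in ball a r, liminf (fun k => ‖F k x - F k y‖ₑ) atTop := by
              refine lintegral_congr_ae ?_
              filter_upwards [haer] with y hy
              exact ((hx.sub hy).enorm.liminf_eq).symm
          _ ≤ _ := lintegral_liminf_le fun k =>
              ((hcont k).comp (by fun_prop : Continuous fun y : Euc n => (x, y))).measurable
    _ ≤ liminf (fun k => ∫⁻ x in ball a r, ∫⁻ y in ball a r, ‖F k x - F k y‖ₑ) atTop :=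
        lintegral_liminf_le fun k => (hcont k).measurable.lintegral_prod_right'
    _ ≤ _ := by
        refine (liminf_le_liminf (Eventually.of_forall hbound)).trans ?_
        simp

lemma setAverage_abs_sub_le_of_lintegral_le {n : ℕ} {f : Euc n → ℝ}
    (hf : LocallyIntegrable f volume) (a : Euc n) {r M : ℝ} (hr : 0 < r) (hM : 0 ≤ M)
    (h : ∫⁻ x in ball a r, ∫⁻ y in ball a r, ‖f x - f y‖ₑ ≤ ENNReal.ofReal M) :
    ⨍ x in ball a r, |f x - ⨍ y in ball a r, f y| ≤ M / volume.real (ball a r) ^ 2 := by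
  have hV := volume_real_ball_pos a hr
  set V := volume.real (ball a r)
  have hint : ∀ c, IntegrableOn (fun y => f y - c) (ball a r) := fun c =>
    (integrableOn_ball_of_locallyIntegrable hf a r).sub (integrableOn_const measure_ball_lt_top.ne)
  set b := ⨍ y in ball a r, f y
  have hpt : ∀ x, ‖f x - b‖ₑ ≤ ENNReal.ofReal V⁻¹ * ∫⁻ y in ball a r, ‖f x - f y‖ₑ := by
    intro x
    have h1 : |b - f x| ≤ V⁻¹ * ∫ y in ball a r, |f y - f x| :=
      (abs_setAverage_sub_le hf a hr (f x)).trans_eq (by rw [setAverage_eq, smul_eq_mul])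
    have h2 := ofReal_integral_norm_eq_lintegral_enorm (hint (f x))
    calc ‖f x - b‖ₑ = ENNReal.ofReal |b - f x| := by
          rw [← neg_sub, enorm_neg, Real.enorm_eq_ofReal_abs]
      _ ≤ ENNReal.ofReal (V⁻¹ * ∫ y in ball a r, |f y - f x|) := ENNReal.ofReal_le_ofReal h1
      _ = ENNReal.ofReal V⁻¹ * ∫⁻ y in ball a r, ‖f y - f x‖ₑ := by
          rw [ENNReal.ofReal_mul (by positivity), ← h2]
          rfl
      _ = _ := by
          congr 1
          refine lintegral_congr fun y => ?_
          rw [← neg_sub, enorm_neg]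
  have h3 : ENNReal.ofReal (∫ x in ball a r, |f x - b|) ≤ ENNReal.ofReal (V⁻¹ * M) := by
    calc ENNReal.ofReal (∫ x in ball a r, |f x - b|)
        = ∫⁻ x in ball a r, ‖f x - b‖ₑ := ofReal_integral_norm_eq_lintegral_enorm (hint b)
      _ ≤ ∫⁻ x in ball a r, ENNReal.ofReal V⁻¹ * ∫⁻ y in ball a r, ‖f x - f y‖ₑ :=
          lintegral_mono hpt
      _ = ENNReal.ofReal V⁻¹ * ∫⁻ x in ball a r, ∫⁻ y in ball a r, ‖f x - f y‖ₑ :=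
          lintegral_const_mul' _ _ ENNReal.ofReal_ne_top
      _ ≤ _ := by
          rw [ENNReal.ofReal_mul (by positivity)]
          gcongr
  rw [ENNReal.ofReal_le_ofReal_iff (by positivity)] at h3
  rw [setAverage_eq, smul_eq_mul]
  calc V⁻¹ * ∫ x in ball a r, |f x - b| ≤ V⁻¹ * (V⁻¹ * M) := by gcongr
    _ = _ := by field_simp

/-- Morrey-type decay of the weak gradient gives Campanato-type decay of the function. -/
lemma oscillation_le_of_isWeakDeriv {n : ℕ} {f : Euc n → ℝ} {g : Fin n → Euc n → ℝ}
    (hf : LocallyIntegrable f volume) (hg : ∀ i, LocallyIntegrable (g i) volume)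
    (h : ∀ i, IsWeakDeriv (EuclideanSpace.single i 1) f (g i)) {K : ℝ} (hK : 0 ≤ K) {k : ℕ}
    (hgK : ∀ i x r, 0 < r → ⨍ y in ball x r, |g i y| ≤ K * (r ^ (k + 1))⁻¹)
    (a : Euc n) {r : ℝ} (hr : 0 < r) :
    ⨍ y in ball a r, |f y - ⨍ z in ball a r, f z| ≤ 2 * 8 ^ n * n * K * (r ^ k)⁻¹ := by
  have hω := volume_real_ball_pos (0 : Euc n) one_pos
  set ω := volume.real (ball (0 : Euc n) 1)
  have h4r : 0 < 4 * r := by positivity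
  have h2r : 0 < 2 * r := by positivity
  set M := 2 * r * ((2 * r) ^ n * ω) * (n * ((4 * r) ^ n * ω * (K * ((4 * r) ^ (k + 1))⁻¹)))
  have hM : 0 ≤ M := by positivity
  have hI : ∀ i, ∫⁻ z in ball a (4 * r), ‖g i z‖ₑ ≤
      ENNReal.ofReal ((4 * r) ^ n * ω * (K * ((4 * r) ^ (k + 1))⁻¹)) := by
    intro i
    have h1 := hgK i a (4 * r) h4r
    have hV := volume_real_ball_pos a h4r
    rw [setAverage_eq, smul_eq_mul, inv_mul_le_iff₀ hV, volume_real_ball a h4r] at h1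
    have h2 := ofReal_integral_norm_eq_lintegral_enorm
      (integrableOn_ball_of_locallyIntegrable (hg i) a (4 * r))
    rw [← h2]
    exact ENNReal.ofReal_le_ofReal h1
  have hvol : volume (ball (0 : Euc n) (2 * r)) = ENNReal.ofReal ((2 * r) ^ n * ω) := by
    rw [← volume_real_ball 0 h2r, Measure.real, ENNReal.ofReal_toReal measure_ball_lt_top.ne]
  have hlin := lintegral_enorm_sub_le_of_isWeakDeriv hf hg h a hr
  have hle : ∫⁻ x in ball a r, ∫⁻ y in ball a r, ‖f x - f y‖ₑ ≤ ENNReal.ofReal M := by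
    refine hlin.trans ?_
    simp only [M]
    rw [hvol, ENNReal.ofReal_mul (p := 2 * r * ((2 * r) ^ n * ω)) (by positivity),
      ENNReal.ofReal_mul (p := 2 * r) (q := (2 * r) ^ n * ω) (by positivity)]
    refine mul_le_mul' le_rfl ((Finset.sum_le_sum fun i _ => hI i).trans (le_of_eq ?_))
    rw [Finset.sum_const, ENNReal.ofReal_mul (p := (n : ℝ)) (by positivity),
      ENNReal.ofReal_natCast, Finset.card_univ, Fintype.card_fin, nsmul_eq_mul]
  refine (setAverage_abs_sub_le_of_lintegral_le hf a hr hM hle).trans ?_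
  rw [volume_real_ball a hr]
  have e : M / (r ^ n * ω) ^ 2 = 2 * 8 ^ n * n * K * (r * ((4 * r) ^ (k + 1))⁻¹) := by
    have e8 : (8 : ℝ) ^ n = 2 ^ n * 4 ^ n := by rw [← mul_pow]; norm_num
    simp only [M]
    rw [e8, mul_pow 2 r n, mul_pow 4 r n]
    field_simp
  rw [e]
  have h5 : r * ((4 * r) ^ (k + 1))⁻¹ ≤ (r ^ k)⁻¹ := by
    calc r * ((4 * r) ^ (k + 1))⁻¹ ≤ r * (r ^ (k + 1))⁻¹ := by
          gcongr
          linarith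
      _ = (r ^ k)⁻¹ := by
          rw [pow_succ]
          field_simp
  gcongr

/-- A Young function dominating the critical power controls the mean oscillation at the scale
dictated by the fractional seminorm. -/
lemma oscillation_le_of_Jfun_le {n m : ℕ} {s c : ℝ} (hm : (m : ℝ) < s) (hsn : s < n)
    (hc : 0 < c) {A : ℝ → ℝ≥0∞}
    (hA : ∀ t, 0 < t → ENNReal.ofReal (c * t ^ ((n : ℝ) / s)) ≤ A t) :
    ∃ C, 0 < C ∧ ∀ (ι : Type) [Fintype ι] (v : Euc n → ι → ℝ) (lam : ℝ), 0 < lam →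
      Jfun n (s - m) A (fun x i => v x i / lam) ≤ 1 → ∀ i,
      LocallyIntegrable (fun x => v x i) volume → ∀ a r, 0 < r →
      ⨍ y in ball a r, |v y i - ⨍ z in ball a r, v z i| ≤ C * lam * (r ^ m)⁻¹ := by
  have hω := volume_real_ball_pos (0 : Euc n) one_pos
  set ω := volume.real (ball (0 : Euc n) 1)
  have hs0 : 0 < s := lt_of_le_of_lt (by positivity) hm
  set p := (n : ℝ) / s with hp
  have hp1 : 1 ≤ p := ((one_lt_div hs0).2 hsn).le
  set σ := s - m with hσ
  have hσ0 : 0 < σ := by simp only [hσ]; linarith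
  have hexp : (n : ℝ) = m * p + σ * p := by
    rw [hp, hσ]
    field_simp
    ring
  set C₀ := (2 : ℝ) ^ (σ * p + n) / c with hC₀
  have hC₀pos : 0 < C₀ := by positivity
  refine ⟨1 + C₀ / ω ^ 2, by positivity, fun ι _ v lam hlam hJ i hv a r hr => ?_⟩
  have hpt : ∀ x ∈ ball a r, ∀ y ∈ ball a r, ‖v x i - v y i‖ₑ ≤
      ENNReal.ofReal (lam * (r ^ m)⁻¹) * (1 + ENNReal.ofReal (C₀ * r ^ (2 * n)) *
        (A (Real.sqrt (∑ j, (v x j / lam - v y j / lam) ^ 2) / ‖x - y‖ ^ σ) /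
          ENNReal.ofReal (‖x - y‖ ^ (n : ℝ)))) := by
    intro x hx y hy
    rcases eq_or_ne (v x i) (v y i) with heq | hne
    · simp [heq]
    have hxy : x ≠ y := by
      rintro rfl
      exact hne rfl
    have hδ : 0 < ‖x - y‖ := norm_pos_iff.2 (sub_ne_zero.2 hxy)
    have hδ2 : ‖x - y‖ ≤ 2 * r := by
      rw [← dist_eq_norm]
      linarith [dist_triangle_right x y a, mem_ball.1 hx, mem_ball.1 hy]
    set δ := ‖x - y‖
    set d := |v x i - v y i| / lam with hd
    have hd0 : 0 < d := div_pos (abs_pos.2 (sub_ne_zero.2 hne)) hlam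
    set S := Real.sqrt (∑ j, (v x j / lam - v y j / lam) ^ 2)
    have hdS : d ≤ S := by
      refine Real.le_sqrt_of_sq_le ?_
      have : d ^ 2 = (v x i / lam - v y i / lam) ^ 2 := by
        rw [hd, div_pow, sq_abs, ← sub_div, div_pow]
      rw [this]
      exact Finset.single_le_sum (f := fun j => (v x j / lam - v y j / lam) ^ 2)
        (fun j _ => sq_nonneg _) (Finset.mem_univ i)
    have hS0 : 0 < S := hd0.trans_le hdS
    have hz : d * r ^ m ≤ 1 + (d * r ^ m) ^ p := by
      rcases le_total (d * r ^ m) 1 with h1 | h1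
      · have : 0 ≤ (d * r ^ m) ^ p := by positivity
        linarith
      · have := Real.rpow_le_rpow_of_exponent_le h1 hp1
        rw [Real.rpow_one] at this
        linarith
    have hpow : (d * r ^ m) ^ p ≤ C₀ * r ^ (2 * n) * (c * (S / δ ^ σ) ^ p / δ ^ (n : ℝ)) := by
      have e1 : (d * r ^ m) ^ p = d ^ p * r ^ ((m : ℝ) * p) := by
        rw [Real.mul_rpow hd0.le (by positivity), ← Real.rpow_natCast r m, ← Real.rpow_mul hr.le]
      have e2 : c * (S / δ ^ σ) ^ p / δ ^ (n : ℝ) = c * S ^ p * (δ ^ (σ * p + n))⁻¹ := by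
        rw [Real.div_rpow hS0.le (by positivity), ← Real.rpow_mul hδ.le, Real.rpow_add hδ]
        field_simp
      have e3 : r ^ ((m : ℝ) * p) =
          2 ^ (σ * p + n) * r ^ (2 * n) * ((2 * r) ^ (σ * p + n))⁻¹ := by
        rw [Real.mul_rpow zero_le_two hr.le, mul_inv]
        have e4 : r ^ (2 * n) = r ^ (2 * (n : ℝ)) := by
          rw [← Real.rpow_natCast]
          push_cast
          rfl
        have e5 : r ^ (2 * (n : ℝ)) = r ^ ((m : ℝ) * p) * r ^ (σ * p + n) := by
          rw [← Real.rpow_add hr]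
          congr 1
          linarith
        rw [e4, e5]
        field_simp
      rw [e1, e2, e3]
      calc d ^ p * (2 ^ (σ * p + n) * r ^ (2 * n) * ((2 * r) ^ (σ * p + n))⁻¹)
          ≤ S ^ p * (2 ^ (σ * p + n) * r ^ (2 * n) * (δ ^ (σ * p + n))⁻¹) := by gcongr
        _ = _ := by
          rw [hC₀]
          field_simp
    have hmain : |v x i - v y i| ≤ lam * (r ^ m)⁻¹ *
        (1 + C₀ * r ^ (2 * n) * (c * (S / δ ^ σ) ^ p / δ ^ (n : ℝ))) := by
      have e : |v x i - v y i| = lam * (r ^ m)⁻¹ * (d * r ^ m) := by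
        rw [hd]
        field_simp
      rw [e]
      gcongr
      linarith
    rw [Real.enorm_eq_ofReal_abs]
    refine (ENNReal.ofReal_le_ofReal hmain).trans ?_
    rw [ENNReal.ofReal_mul (by positivity), ENNReal.ofReal_add zero_le_one (by positivity),
      ENNReal.ofReal_one, ENNReal.ofReal_mul (p := C₀ * r ^ (2 * n)) (by positivity),
      ENNReal.ofReal_div_of_pos (by positivity)]
    gcongr
    exact hA _ (by positivity)
  have hV : volume (ball a r) = ENNReal.ofReal (r ^ n * ω) := by
    rw [← volume_real_ball a hr, Measure.real, ENNReal.ofReal_toReal measure_ball_lt_top.ne]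
  set Q : Euc n → Euc n → ℝ≥0∞ := fun x y =>
    A (Real.sqrt (∑ j, (v x j / lam - v y j / lam) ^ 2) / ‖x - y‖ ^ σ) /
      ENNReal.ofReal (‖x - y‖ ^ (n : ℝ))
  have hQ : ∫⁻ x in ball a r, ∫⁻ y in ball a r, Q x y ≤ 1 :=
    (setLIntegral_le_lintegral _ _).trans
      ((lintegral_mono fun x => setLIntegral_le_lintegral _ _).trans hJ)
  have hle : ∫⁻ x in ball a r, ∫⁻ y in ball a r, ‖v x i - v y i‖ₑ ≤
      ENNReal.ofReal (lam * (r ^ m)⁻¹ * ((r ^ n * ω) ^ 2 + C₀ * r ^ (2 * n))) := by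
    calc ∫⁻ x in ball a r, ∫⁻ y in ball a r, ‖v x i - v y i‖ₑ
        ≤ ∫⁻ x in ball a r, ∫⁻ y in ball a r, ENNReal.ofReal (lam * (r ^ m)⁻¹) *
          (1 + ENNReal.ofReal (C₀ * r ^ (2 * n)) * Q x y) :=
          setLIntegral_mono' measurableSet_ball fun x hx =>
            setLIntegral_mono' measurableSet_ball fun y hy => hpt x hx y hy
      _ = ENNReal.ofReal (lam * (r ^ m)⁻¹) * (volume (ball a r) * volume (ball a r) +
          ENNReal.ofReal (C₀ * r ^ (2 * n)) * ∫⁻ x in ball a r, ∫⁻ y in ball a r, Q x y) := by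
          simp_rw [lintegral_const_mul' _ _ ENNReal.ofReal_ne_top,
            lintegral_add_left measurable_const, lintegral_const_mul' _ _ ENNReal.ofReal_ne_top]
          simp
      _ ≤ ENNReal.ofReal (lam * (r ^ m)⁻¹) * (volume (ball a r) * volume (ball a r) +
          ENNReal.ofReal (C₀ * r ^ (2 * n)) * 1) := by gcongr
      _ = _ := by
          rw [hV, mul_one, ← ENNReal.ofReal_mul (by positivity),
            ← ENNReal.ofReal_add (by positivity) (by positivity),
            ← ENNReal.ofReal_mul (by positivity), pow_two]
  refine (setAverage_abs_sub_le_of_lintegral_le hv a hr (by positivity) hle).trans (le_of_eq ?_)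
  rw [volume_real_ball a hr]
  change _ / (r ^ n * ω) ^ 2 = _
  field_simp
  ring

lemma iteratedFDeriv_succ_apply_single {n h : ℕ} {φ : Euc n → ℝ}
    (hφ : ContDiff ℝ (⊤ : ℕ∞) φ) (d : Fin (h + 1) → Fin n) (x : Euc n) :
    iteratedFDeriv ℝ (h + 1) φ x (fun j => EuclideanSpace.single (d j) (1 : ℝ)) =
      iteratedFDeriv ℝ h (fun y => fderiv ℝ φ y (EuclideanSpace.single (d (Fin.last h)) 1)) x
        (fun j => EuclideanSpace.single ((Fin.init d : Fin h → Fin n) j) (1 : ℝ)) := by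
  have h4 : ContDiff ℝ h (fun y => fderiv ℝ φ y) :=
    hφ.fderiv_right (m := h) (by exact_mod_cast le_top)
  rw [iteratedFDeriv_succ_apply_right, iteratedFDeriv_clm_apply_const_apply h4 le_rfl]
  rfl

lemma HasWeakDerivs.isWeakDeriv {n m : ℕ} {u : Euc n → ℝ}
    {D : (h : ℕ) → Euc n → (Fin h → Fin n) → ℝ} (hD : HasWeakDerivs n m u D) {h : ℕ}
    (hm : h + 1 ≤ m) (d : Fin h → Fin n) (i : Fin n) :
    IsWeakDeriv (EuclideanSpace.single i 1) (fun x => D h x d)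
      (fun x => D (h + 1) x (Fin.snoc d i)) := by
  intro φ hφ hφc
  have hψ : ContDiff ℝ (⊤ : ℕ∞) fun x => fderiv ℝ φ x (EuclideanSpace.single i 1) :=
    (hφ.fderiv_right (by simp)).clm_apply contDiff_const
  have hψc : HasCompactSupport fun x => fderiv ℝ φ x (EuclideanSpace.single i 1) :=
    hφc.fderiv_apply ℝ _
  have h1 := (hD.2 h (by omega) d).2 _ hψ hψc
  have h2 := (hD.2 (h + 1) hm (Fin.snoc d i)).2 φ hφ hφc
  simp only [iteratedFDeriv_succ_apply_single hφ, Fin.init_snoc, Fin.snoc_last] at h2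
  rw [h1, pow_succ, mul_assoc] at h2
  have := mul_left_cancel₀ (pow_ne_zero h (by norm_num : (-1 : ℝ) ≠ 0)) h2
  simpa using this

/-- Campanato decay of the top-order weak derivatives descends to bounded mean oscillation of the
function itself, provided the lower order derivatives vanish at infinity. -/
lemma HasWeakDerivs.oscillation_descent {n m : ℕ} (hn : 0 < n) {u : Euc n → ℝ}
    {D : (h : ℕ) → Euc n → (Fin h → Fin n) → ℝ} (hD : HasWeakDerivs n m u D)
    (hdec : DecayFrom n 1 m D) (h : ℕ) (hm : h ≤ m) {K : ℝ} (hK : 0 ≤ K)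
    (hosc : ∀ d x r, 0 < r →
      ⨍ y in ball x r, |D h y d - ⨍ z in ball x r, D h z d| ≤ K * (r ^ h)⁻¹)
    (x : Euc n) {r : ℝ} (hr : 0 < r) :
    ⨍ y in ball x r, |u y - ⨍ z in ball x r, u z| ≤
      (2 * 8 ^ n * n * (2 ^ n + 3)) ^ h * K := by
  induction h generalizing K with
  | zero =>
    have := hosc Fin.elim0 x r hr
    simp only [hD.1] at this
    simpa using this
  | succ h ih =>
    have hmor : ∀ d x r, 0 < r →
        ⨍ y in ball x r, |D (h + 1) y d| ≤ (2 ^ n + 3) * K * (r ^ (h + 1))⁻¹ := by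
      intro d x r hr
      refine setAverage_abs_le_of_oscillation hn (hD.2 (h + 1) hm d).1 ?_ hK h.succ_ne_zero
        (hosc d) x hr
      intro t ht
      refine (measure_mono ?_).trans_lt (hdec (h + 1) (by omega) hm t ht)
      intro y hy
      refine lt_of_lt_of_le (show t < |D (h + 1) y d| from hy) ?_
      refine Real.le_sqrt_of_sq_le ?_
      rw [sq_abs]
      exact Finset.single_le_sum (f := fun d => (D (h + 1) y d) ^ 2) (fun _ _ => sq_nonneg _)
        (Finset.mem_univ d)
    have := ih (by omega) (K := 2 * 8 ^ n * n * ((2 ^ n + 3) * K)) (by positivity)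
      fun d x r hr => oscillation_le_of_isWeakDeriv (hD.2 h (by omega) d).1
        (fun i => (hD.2 (h + 1) hm (Fin.snoc d i)).1) (hD.isWeakDeriv hm d) (by positivity)
        (fun i x r hr => hmor (Fin.snoc d i) x r hr) x hr
    refine this.trans (le_of_eq ?_)
    rw [pow_succ]
    ring

/-- Sufficiency: a Young function dominating the critical power yields the embedding in `BMO`. -/
lemma exists_campSem_le_of_rpow_le {n m : ℕ} (hn : 0 < n) {s c : ℝ} (hm : (m : ℝ) < s)
    (hsn : s < n) (hc : 0 < c) {A : ℝ → ℝ≥0∞}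
    (hA : ∀ t, 0 < t → ENNReal.ofReal (c * t ^ ((n : ℝ) / s)) ≤ A t) :
    ∃ c' : ℝ, 0 < c' ∧
      ∀ (u : Euc n → ℝ) (D : (h : ℕ) → Euc n → (Fin h → Fin n) → ℝ),
        HasWeakDerivs n m u D → DecayFrom n 1 m D →
        campSem n (fun _ => 1) u ≤ ENNReal.ofReal c' * fracSem n (s - m) A (D m) := by
  obtain ⟨C, hC, h⟩ := oscillation_le_of_Jfun_le hm hsn hc hA
  refine ⟨(2 * 8 ^ n * n * (2 ^ n + 3)) ^ m * C, by positivity, fun u D hD hdec => ?_⟩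
  set c' := ((2 : ℝ) * 8 ^ n * n * (2 ^ n + 3)) ^ m * C
  have hc' : 0 < c' := by positivity
  rw [mul_comm, ← ENNReal.div_le_iff_le_mul (Or.inl (by simpa using hc')) (Or.inl ENNReal.ofReal_ne_top)]
  refine le_sInf ?_
  rintro _ ⟨lam, ⟨hlam, hJ⟩, rfl⟩
  rw [ENNReal.div_le_iff_le_mul (Or.inl (by simpa using hc')) (Or.inl ENNReal.ofReal_ne_top),
    ← ENNReal.ofReal_mul hlam.le]
  refine iSup_le fun x => iSup_le fun r => iSup_le fun hr => ENNReal.ofReal_le_ofReal ?_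
  rw [oscQuot, inv_one, one_mul]
  refine (hD.oscillation_descent hn hdec m le_rfl (K := C * lam) (by positivity)
    (fun d x r hr => h _ (D m) lam hlam hJ d (hD.2 m le_rfl d).1 x r hr) x hr).trans
    (le_of_eq ?_)
  simp only [c']
  ring

/-- The iterated classical partial derivatives of a scalar function. -/
noncomputable def iterPartial {n : ℕ} (u : Euc n → ℝ) : (h : ℕ) → Euc n → (Fin h → Fin n) → ℝ
  | 0, x, _ => u x
  | h + 1, x, d => fderiv ℝ (fun y => iterPartial u h y (Fin.init d)) x
      (EuclideanSpace.single (d (Fin.last h)) 1)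

lemma contDiff_iterPartial {n : ℕ} {u : Euc n → ℝ} (hu : ContDiff ℝ (⊤ : ℕ∞) u) (h : ℕ)
    (d : Fin h → Fin n) : ContDiff ℝ (⊤ : ℕ∞) fun x => iterPartial u h x d := by
  induction h with
  | zero => exact hu
  | succ h ih => exact ((ih (Fin.init d)).fderiv_right (by simp)).clm_apply contDiff_const

lemma hasCompactSupport_iterPartial {n : ℕ} {u : Euc n → ℝ} (hu : HasCompactSupport u) (h : ℕ)
    (d : Fin h → Fin n) : HasCompactSupport fun x => iterPartial u h x d := by
  induction h with
  | zero => exact hu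
  | succ h ih => exact (ih (Fin.init d)).fderiv_apply ℝ _

lemma iterPartial_comp_smul {n : ℕ} (u : Euc n → ℝ) (c : ℝ) (h : ℕ) (x : Euc n)
    (d : Fin h → Fin n) :
    iterPartial (fun y => u (c • y)) h x d = c ^ h * iterPartial u h (c • x) d := by
  induction h generalizing x with
  | zero => simp [iterPartial]
  | succ h ih =>
    simp only [iterPartial, ih]
    have h1 := fderiv_comp_smul (f := fun y => iterPartial u h y (Fin.init d)) (x := x) c
    have h2 : (fun y => c ^ h * iterPartial u h (c • y) (Fin.init d)) =
        c ^ h • fun y => iterPartial u h (c • y) (Fin.init d) := rfl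
    rw [h2, fderiv_const_smul_field, Pi.smul_apply, h1]
    simp only [_root_.smul_apply, smul_eq_mul]
    ring

lemma integral_mul_iteratedFDeriv_eq {n : ℕ} {u : Euc n → ℝ} (hu : ContDiff ℝ (⊤ : ℕ∞) u)
    (huc : HasCompactSupport u) (h : ℕ) (d : Fin h → Fin n) {φ : Euc n → ℝ}
    (hφ : ContDiff ℝ (⊤ : ℕ∞) φ) :
    ∫ x : Euc n, u x * iteratedFDeriv ℝ h φ x (fun i => EuclideanSpace.single (d i) (1 : ℝ)) =
      (-1 : ℝ) ^ h * ∫ x : Euc n, iterPartial u h x d * φ x := by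
  induction h generalizing φ with
  | zero => simp [iterPartial]
  | succ h ih =>
    set e : Euc n := EuclideanSpace.single (d (Fin.last h)) 1
    have hψ : ContDiff ℝ (⊤ : ℕ∞) fun x => fderiv ℝ φ x e :=
      (hφ.fderiv_right (by simp)).clm_apply contDiff_const
    set g := fun x => iterPartial u h x (Fin.init d)
    have hg : ContDiff ℝ (⊤ : ℕ∞) g := contDiff_iterPartial hu h _
    have hgc : HasCompactSupport g := hasCompactSupport_iterPartial huc h _
    have hg' : ContDiff ℝ (⊤ : ℕ∞) fun x => fderiv ℝ g x e :=
      (hg.fderiv_right (by simp)).clm_apply contDiff_const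
    simp only [iteratedFDeriv_succ_apply_single hφ]
    rw [ih (Fin.init d) hψ, pow_succ, mul_assoc, neg_one_mul]
    congr 1
    exact integral_mul_fderiv_eq_neg_fderiv_mul_of_integrable
      ((hg'.continuous.mul hφ.continuous).integrable_of_hasCompactSupport
        (HasCompactSupport.mul_right (hgc.fderiv_apply ℝ e)))
      ((hg.continuous.mul hψ.continuous).integrable_of_hasCompactSupport hgc.mul_right)
      ((hg.continuous.mul hφ.continuous).integrable_of_hasCompactSupport hgc.mul_right)
      (fun x _ => hg.differentiable (by simp) x) (fun x _ => hφ.differentiable (by simp) x)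

lemma hasWeakDerivs_iterPartial {n : ℕ} {u : Euc n → ℝ} (hu : ContDiff ℝ (⊤ : ℕ∞) u)
    (huc : HasCompactSupport u) (m : ℕ) : HasWeakDerivs n m u (iterPartial u) :=
  ⟨fun _ _ => rfl, fun h _ d => ⟨(contDiff_iterPartial hu h d).continuous.locallyIntegrable,
    fun _ hφ _ => integral_mul_iteratedFDeriv_eq hu huc h d hφ⟩⟩

lemma decayFrom_iterPartial {n : ℕ} {u : Euc n → ℝ} (huc : HasCompactSupport u) (k m : ℕ) :
    DecayFrom n k m (iterPartial u) := by
  intro h _ _ t ht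
  refine (measure_mono ?_).trans_lt
    (isCompact_iUnion fun d => hasCompactSupport_iterPartial huc h d).measure_lt_top
  intro x hx
  by_contra hcon
  have h0 : ∀ d, iterPartial u h x d = 0 := fun d => by
    by_contra hne
    exact hcon (mem_iUnion.2 ⟨d, subset_tsupport _ hne⟩)
  have h1 : t < gradLen n (iterPartial u) h x := hx
  simp [gradLen, h0] at h1
  linarith

lemma setAverage_ball_comp_smul {n : ℕ} (f : Euc n → ℝ) {r R : ℝ} (hr : 0 < r) (hR : 0 < R) :
    ⨍ x in ball (0 : Euc n) (r * R), f (r⁻¹ • x) = ⨍ x in ball (0 : Euc n) R, f x := by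
  have hω := volume_real_ball_pos (0 : Euc n) one_pos
  rw [setAverage_eq, setAverage_eq, Measure.setIntegral_comp_smul_of_pos _ _ _ (inv_pos.2 hr),
    _root_.smul_ball (inv_pos.2 hr).ne', smul_zero, finrank_euclideanSpace_fin, Real.norm_eq_abs,
    abs_of_pos (inv_pos.2 hr), inv_mul_cancel_left₀ hr.ne', volume_real_ball _ hR,
    volume_real_ball _ (mul_pos hr hR)]
  simp only [smul_eq_mul, inv_pow, inv_inv]
  rw [mul_pow]
  field_simp

lemma oscQuot_comp_smul {n : ℕ} (u : Euc n → ℝ) {r R : ℝ} (hr : 0 < r) (hR : 0 < R) :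
    oscQuot n (fun _ => 1) (fun x => u (r⁻¹ • x)) 0 (r * R) = oscQuot n (fun _ => 1) u 0 R := by
  rw [oscQuot, oscQuot, setAverage_ball_comp_smul u hr hR,
    setAverage_ball_comp_smul (fun y => |u y - ⨍ z in ball (0 : Euc n) R, u z|) hr hR]

lemma lintegral_comp_inv_smul {n : ℕ} (f : Euc n → ℝ≥0∞) {r : ℝ} (hr : 0 < r) :
    ∫⁻ x, f (r⁻¹ • x) = ENNReal.ofReal (r ^ n) * ∫⁻ x, f x := by
  have h := (measurableEmbedding_const_smul₀ (α := Euc n) (inv_pos.2 hr).ne').lintegral_map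
    (μ := volume) f
  rw [← h, Measure.map_addHaar_smul _ (inv_pos.2 hr).ne', lintegral_smul_measure,
    finrank_euclideanSpace_fin, inv_pow, inv_inv, abs_of_pos (by positivity), smul_eq_mul]

/-- A continuous function that is not constant on a ball has positive mean oscillation there. -/
lemma oscQuot_pos {n : ℕ} {u : Euc n → ℝ} (hu : Continuous u) {a x y : Euc n} {r : ℝ} (hr : 0 < r)
    (hx : x ∈ ball a r) (hy : y ∈ ball a r) (hxy : u x ≠ u y) :
    0 < oscQuot n (fun _ => 1) u a r := by
  set b := ⨍ z in ball a r, u z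
  have hV := volume_real_ball_pos a hr
  obtain ⟨w, hw, hwb⟩ : ∃ w ∈ ball a r, u w ≠ b := by
    by_contra! hcon
    exact hxy ((hcon x hx).trans (hcon y hy).symm)
  have hc : Continuous fun z => |u z - b| := (hu.sub continuous_const).abs
  rw [oscQuot, inv_one, one_mul, setAverage_eq, smul_eq_mul]
  refine mul_pos (inv_pos.2 hV) ?_
  rw [setIntegral_pos_iff_support_of_nonneg_ae (ae_of_all _ fun z => abs_nonneg _)
    (integrableOn_ball_of_locallyIntegrable hc.locallyIntegrable a r)]
  refine IsOpen.measure_pos _ (hc.isOpen_support.inter isOpen_ball) ⟨w, ?_, hw⟩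
  simpa [sub_eq_zero] using hwb

lemma ContDiff.exists_norm_sub_le_min {n : ℕ} {F : Type*} [NormedAddCommGroup F]
    [NormedSpace ℝ F] {f : Euc n → F} (hf : ContDiff ℝ 1 f) (hfc : HasCompactSupport f) :
    ∃ L, 0 < L ∧ ∀ x y, ‖f x - f y‖ ≤ L * min ‖x - y‖ 1 := by
  obtain ⟨C, hC⟩ := hf.lipschitzWith_of_hasCompactSupport hfc one_ne_zero
  obtain ⟨B, hB⟩ := hf.continuous.bounded_above_of_compact_support hfc
  have hB0 : 0 ≤ B := (norm_nonneg _).trans (hB 0)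
  refine ⟨C + 2 * B + 1, by positivity, fun x y => ?_⟩
  rcases le_total ‖x - y‖ 1 with h | h
  · rw [min_eq_left h]
    have := hC.norm_sub_le x y
    nlinarith [norm_nonneg (x - y)]
  · rw [min_eq_right h]
    have := norm_sub_le (f x) (f y)
    have := hB x
    have := hB y
    have := C.2
    linarith

lemma integrable_min_norm_one_mul_rpow {n : ℕ} (hn : 0 < n) {σ : ℝ} (hσ0 : 0 < σ) (hσ1 : σ < 1) :
    Integrable (fun z : Euc n => min ‖z‖ 1 * ‖z‖ ^ (-σ - n)) volume := by
  have : Nonempty (Fin n) := ⟨⟨0, hn⟩⟩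
  rw [integrable_fun_norm_addHaar (μ := (volume : Measure (Euc n)))
    (f := fun y => min y 1 * y ^ (-σ - n)), finrank_euclideanSpace_fin,
    ← Ioc_union_Ioi_eq_Ioi (zero_le_one' ℝ)]
  have key : ∀ y : ℝ, 0 < y → y ^ (n - 1) • (min y 1 * y ^ (-σ - n)) =
      min y 1 * y ^ (-σ - 1) := by
    intro y hy
    have h1 : y ^ (n - 1) = y ^ ((n : ℝ) - 1) := by
      rw [← Real.rpow_natCast, Nat.cast_pred hn]
    rw [smul_eq_mul, h1, mul_left_comm, ← Real.rpow_add hy]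
    ring_nf
  refine IntegrableOn.union ?_ ?_
  · have h1 : IntegrableOn (fun y : ℝ => y ^ (-σ)) (Ioc 0 1) := by
      have := intervalIntegral.intervalIntegrable_rpow' (a := 0) (b := 1) (r := -σ) (by linarith)
      rwa [intervalIntegrable_iff_integrableOn_Ioc_of_le zero_le_one] at this
    refine h1.congr_fun (fun y hy => ?_) measurableSet_Ioc
    change y ^ (-σ) = y ^ (n - 1) • (min y 1 * y ^ (-σ - n))
    rw [key y hy.1, min_eq_left hy.2, Real.rpow_sub_one hy.1.ne']
    field_simp [hy.1.ne']
  · refine (integrableOn_Ioi_rpow_of_lt (a := -σ - 1) (by linarith) one_pos).congr_fun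
      (fun y hy => ?_) measurableSet_Ioi
    change y ^ (-σ - 1) = y ^ (n - 1) • (min y 1 * y ^ (-σ - n))
    rw [key y (one_pos.trans hy), min_eq_right (mem_Ioi.1 hy).le, one_mul]

/-- Compactly supported continuously differentiable maps have finite fractional energy. -/
lemma lintegral_norm_sub_div_rpow_lt_top {n : ℕ} (hn : 0 < n) {σ : ℝ} (hσ0 : 0 < σ)
    (hσ1 : σ < 1) {F : Type*} [NormedAddCommGroup F] [NormedSpace ℝ F] {f : Euc n → F}
    (hf : ContDiff ℝ 1 f) (hfc : HasCompactSupport f) :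
    ∫⁻ x, ∫⁻ y, ENNReal.ofReal (‖f x - f y‖ / ‖x - y‖ ^ σ) / ENNReal.ofReal (‖x - y‖ ^ (n : ℝ)) <
      ⊤ := by
  obtain ⟨L, hL, hLip⟩ := hf.exists_norm_sub_le_min hfc
  set S := tsupport f
  have hS : IsCompact S := hfc
  set k : Euc n → ℝ≥0∞ := fun z => ENNReal.ofReal (L * (min ‖z‖ 1 * ‖z‖ ^ (-σ - n)))
  have hk : Measurable k := by fun_prop
  have hkint : ∫⁻ z, k z < ⊤ :=
    ((integrable_min_norm_one_mul_rpow hn hσ0 hσ1).const_mul L).lintegral_lt_top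
  set χ : Euc n → ℝ≥0∞ := S.indicator 1
  have hχ : Measurable χ := measurable_one.indicator hS.measurableSet
  have hχint : ∫⁻ z, χ z = volume S := lintegral_indicator_one hS.measurableSet
  have hpt : ∀ x y, ENNReal.ofReal (‖f x - f y‖ / ‖x - y‖ ^ σ) /
      ENNReal.ofReal (‖x - y‖ ^ (n : ℝ)) ≤ χ x * k (x - y) + χ y * k (x - y) := by
    intro x y
    rcases eq_or_ne (f x) (f y) with heq | hne
    · simp [heq]
    have hxy : 0 < ‖x - y‖ := norm_pos_iff.2 (sub_ne_zero.2 fun h => hne (by rw [h]))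
    have h1 : ENNReal.ofReal (‖f x - f y‖ / ‖x - y‖ ^ σ) / ENNReal.ofReal (‖x - y‖ ^ (n : ℝ)) ≤
        k (x - y) := by
      rw [← ENNReal.ofReal_div_of_pos (by positivity)]
      refine ENNReal.ofReal_le_ofReal ?_
      rw [Real.rpow_sub hxy, Real.rpow_neg hxy.le, div_div, div_le_iff₀ (by positivity)]
      refine (hLip x y).trans (le_of_eq ?_)
      field_simp
    refine h1.trans ?_
    have h2 : 1 ≤ χ x + χ y := by
      by_cases hx : x ∈ S
      · simp [χ, hx]
      · have hy : y ∈ S := by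
          by_contra hy
          exact hne ((image_eq_zero_of_notMem_tsupport hx).trans
            (image_eq_zero_of_notMem_tsupport hy).symm)
        simp [χ, hy]
    rw [← add_mul]
    exact le_mul_of_one_le_left' h2
  have hI1 : ∫⁻ x, ∫⁻ y, χ x * k (x - y) = volume S * ∫⁻ z, k z := by
    have : ∀ x, ∫⁻ y, χ x * k (x - y) = χ x * ∫⁻ z, k z := fun x => by
      rw [lintegral_const_mul _ (by fun_prop), lintegral_sub_left_eq_self k x]
    simp_rw [this]
    rw [lintegral_mul_const _ hχ, hχint]
  have hI2 : ∫⁻ x, ∫⁻ y, χ y * k (x - y) = volume S * ∫⁻ z, k z := by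
    rw [lintegral_lintegral_swap
      ((hχ.comp measurable_snd).mul (hk.comp (measurable_fst.sub measurable_snd))).aemeasurable]
    have : ∀ y, ∫⁻ x, χ y * k (x - y) = χ y * ∫⁻ z, k z := fun y => by
      rw [lintegral_const_mul _ (by fun_prop), lintegral_sub_right_eq_self k y]
    simp_rw [this]
    rw [lintegral_mul_const _ hχ, hχint]
  calc _ ≤ ∫⁻ x, ∫⁻ y, (χ x * k (x - y) + χ y * k (x - y)) :=
        lintegral_mono fun x => lintegral_mono fun y => hpt x y
    _ = (∫⁻ x, ∫⁻ y, χ x * k (x - y)) + ∫⁻ x, ∫⁻ y, χ y * k (x - y) := by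
        rw [← lintegral_add_left]
        · refine lintegral_congr fun x => lintegral_add_left (by fun_prop) _
        · exact ((hχ.comp measurable_fst).mul
            (hk.comp (measurable_fst.sub measurable_snd))).lintegral_prod_right'
    _ < ⊤ := by
        rw [hI1, hI2]
        have := ENNReal.mul_lt_top (hS.measure_lt_top (μ := volume)) hkint
        exact ENNReal.add_lt_top.2 ⟨this, this⟩

lemma sqrt_sum_sq_eq_norm {ι : Type*} [Fintype ι] (v w : ι → ℝ) :
    Real.sqrt (∑ i, (v i - w i) ^ 2) = ‖WithLp.toLp 2 v - WithLp.toLp 2 w‖ := by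
  rw [EuclideanSpace.norm_eq]
  simp

/-- The modular of a rescaled map, bounded through its values on a single argument. -/
lemma Jfun_comp_smul_le {n m : ℕ} {s M r lam : ℝ} (hM : 0 < M) (hr : 0 < r) (hlam : 0 < lam)
    {A : ℝ → ℝ≥0∞} (hA : IsYoung A) {ι : Type} [Fintype ι] {G : Euc n → ι → ℝ}
    (hG : ∀ x y, ‖WithLp.toLp 2 (G x) - WithLp.toLp 2 (G y)‖ ≤ M * ‖x - y‖ ^ (s - m))
    (hT : A (M / (lam * r ^ s)) ≠ ⊤) :
    Jfun n (s - m) A (fun x i => r⁻¹ ^ m * G (r⁻¹ • x) i / lam) ≤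
      A (M / (lam * r ^ s)) * (ENNReal.ofReal (r ^ n / M) *
        ∫⁻ x, ∫⁻ y, ENNReal.ofReal
          (‖WithLp.toLp 2 (G x) - WithLp.toLp 2 (G y)‖ / ‖x - y‖ ^ (s - m)) /
            ENNReal.ofReal (‖x - y‖ ^ (n : ℝ))) := by
  set T := M / (lam * r ^ s) with hTdef
  set σ := s - m with hσ
  set f : Euc n → EuclideanSpace ℝ ι := fun x => WithLp.toLp 2 (G x)
  set H : Euc n → Euc n → ℝ≥0∞ := fun x y =>
    ENNReal.ofReal (‖f x - f y‖ / ‖x - y‖ ^ σ) / ENNReal.ofReal (‖x - y‖ ^ (n : ℝ))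
  have hT0 : 0 ≤ T := by positivity
  have hrs : r ^ s = r ^ m * r ^ σ := by
    rw [← Real.rpow_natCast r m, ← Real.rpow_add hr, hσ]
    ring_nf
  have hpt : ∀ x y : Euc n,
      A (Real.sqrt (∑ i, (r⁻¹ ^ m * G (r⁻¹ • x) i / lam - r⁻¹ ^ m * G (r⁻¹ • y) i / lam) ^ 2) /
        ‖x - y‖ ^ σ) / ENNReal.ofReal (‖x - y‖ ^ (n : ℝ)) ≤
      A T * ENNReal.ofReal (M⁻¹ * (r ^ n)⁻¹) * H (r⁻¹ • x) (r⁻¹ • y) := by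
    intro x y
    have e1 : ‖x - y‖ = r * ‖r⁻¹ • x - r⁻¹ • y‖ := by
      rw [← smul_sub, norm_smul, norm_inv, Real.norm_eq_abs, abs_of_pos hr,
        mul_inv_cancel_left₀ hr.ne']
    set x' := r⁻¹ • x
    set y' := r⁻¹ • y
    set ρ := ‖x' - y'‖
    have hρ : 0 ≤ ρ := norm_nonneg _
    have e2 : Real.sqrt (∑ i, (r⁻¹ ^ m * G x' i / lam - r⁻¹ ^ m * G y' i / lam) ^ 2) =
        r⁻¹ ^ m / lam * ‖f x' - f y'‖ := by
      rw [← sqrt_sum_sq_eq_norm, ← Real.sqrt_sq (show 0 ≤ r⁻¹ ^ m / lam by positivity),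
        ← Real.sqrt_mul (sq_nonneg _), Finset.mul_sum]
      congr 1
      refine Finset.sum_congr rfl fun i _ => ?_
      ring
    have e3 : r⁻¹ ^ m / lam * ‖f x' - f y'‖ / (r * ρ) ^ σ =
        ‖f x' - f y'‖ / ρ ^ σ / M * T := by
      rw [Real.mul_rpow hr.le hρ, hTdef, hrs, inv_pow]
      field_simp
    have hle : ‖f x' - f y'‖ / ρ ^ σ / M ≤ 1 := by
      rw [div_le_one hM]
      exact div_le_of_le_mul₀ (by positivity) hM.le (hG x' y')
    rw [e2, e1, e3]
    refine (ENNReal.div_le_div_right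
      (hA.apply_mul_le (by positivity) hle hT0) _).trans (le_of_eq ?_)
    rw [Real.mul_rpow hr.le hρ, Real.rpow_natCast r n, div_eq_mul_inv _ M, mul_comm _ M⁻¹,
      ENNReal.ofReal_mul (by positivity), ENNReal.ofReal_mul (p := r ^ n) (by positivity),
      ENNReal.ofReal_mul (p := M⁻¹) (by positivity), ENNReal.ofReal_inv_of_pos hM,
      ENNReal.ofReal_inv_of_pos (pow_pos hr n)]
    simp only [H, ENNReal.div_eq_inv_mul]
    rw [ENNReal.mul_inv (Or.inl (by simpa using pow_pos hr n)) (Or.inl ENNReal.ofReal_ne_top)]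
    ring
  calc Jfun n σ A (fun x i => r⁻¹ ^ m * G (r⁻¹ • x) i / lam)
      ≤ ∫⁻ x, ∫⁻ y, A T * ENNReal.ofReal (M⁻¹ * (r ^ n)⁻¹) * H (r⁻¹ • x) (r⁻¹ • y) :=
        lintegral_mono fun x => lintegral_mono fun y => hpt x y
    _ = A T * ENNReal.ofReal (M⁻¹ * (r ^ n)⁻¹) *
        (ENNReal.ofReal (r ^ n) * (ENNReal.ofReal (r ^ n) * ∫⁻ x, ∫⁻ y, H x y)) := by
        have hc := ENNReal.mul_ne_top hT (ENNReal.ofReal_ne_top (r := M⁻¹ * (r ^ n)⁻¹))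
        simp_rw [lintegral_const_mul' _ _ hc, lintegral_comp_inv_smul (H _) hr,
          lintegral_const_mul' _ _ ENNReal.ofReal_ne_top]
        rw [lintegral_comp_inv_smul (fun x => ∫⁻ y, H x y) hr]
    _ = _ := by
        have e : ENNReal.ofReal (r ^ n / M) =
            ENNReal.ofReal (M⁻¹ * (r ^ n)⁻¹) * (ENNReal.ofReal (r ^ n) * ENNReal.ofReal (r ^ n)) := by
          rw [← ENNReal.ofReal_mul (by positivity), ← ENNReal.ofReal_mul (by positivity)]
          congr 1
          field_simp
        rw [e]
        ring

/-- Necessity: the embedding in `BMO` forces the Young function to dominate the critical power. -/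
lemma exists_rpow_le_of_campSem_le {n m : ℕ} (hn : 0 < n) {s : ℝ} (hm : (m : ℝ) < s)
    (hm1 : s < m + 1) {A : ℝ → ℝ≥0∞} (hA : IsYoung A) {c' : ℝ} (hc' : 0 < c')
    (h : ∀ (u : Euc n → ℝ) (D : (h : ℕ) → Euc n → (Fin h → Fin n) → ℝ),
      HasWeakDerivs n m u D → DecayFrom n 1 m D → fracSem n (s - m) A (D m) < ⊤ →
      campSem n (fun _ => 1) u ≤ ENNReal.ofReal c' * fracSem n (s - m) A (D m)) :
    ∃ c : ℝ, 0 < c ∧ ∀ t : ℝ, 0 < t → ENNReal.ofReal (c * t ^ ((n : ℝ) / s)) ≤ A t := by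
  have hs0 : 0 < s := lt_of_le_of_lt (by positivity) hm
  have hσ0 : 0 < s - m := by linarith
  let b : ContDiffBump (0 : Euc n) := ⟨1, 2, one_pos, one_lt_two⟩
  set u : Euc n → ℝ := fun x => b x
  have hu : ContDiff ℝ (⊤ : ℕ∞) u := b.contDiff
  have huc : HasCompactSupport u := b.hasCompactSupport
  have hδ : 0 < oscQuot n (fun _ => 1) u 0 3 := by
    have he : ‖(5 / 2 : ℝ) • EuclideanSpace.single (⟨0, hn⟩ : Fin n) (1 : ℝ)‖ = 5 / 2 := by
      simp [norm_smul]
    refine oscQuot_pos hu.continuous three_pos (x := 0)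
      (y := (5 / 2 : ℝ) • EuclideanSpace.single (⟨0, hn⟩ : Fin n) (1 : ℝ)) (by simp) ?_ ?_
    · rw [mem_ball_zero_iff, he]
      norm_num
    · have h1 : u 0 = 1 := b.one_of_mem_closedBall (by simp [b])
      have h2 : u ((5 / 2 : ℝ) • EuclideanSpace.single (⟨0, hn⟩ : Fin n) (1 : ℝ)) = 0 :=
        b.zero_of_le_dist (by rw [dist_zero_right, he]; simp only [b]; norm_num)
      rw [h1, h2]
      exact one_ne_zero
  set δ := oscQuot n (fun _ => 1) u 0 3
  set G := iterPartial u m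
  set f : Euc n → EuclideanSpace ℝ (Fin m → Fin n) := fun x => WithLp.toLp 2 (G x)
  have hf : ContDiff ℝ 1 f := contDiff_euclidean.2 fun d =>
    (contDiff_iterPartial hu m d).of_le (by exact_mod_cast le_top)
  have hfc : HasCompactSupport f :=
    HasCompactSupport.intro (isCompact_iUnion fun d => hasCompactSupport_iterPartial huc m d)
      fun x hx => by
        ext d
        by_contra hne
        exact hx (mem_iUnion.2 ⟨d, subset_tsupport _ hne⟩)
  obtain ⟨M, hM, hfM⟩ := hf.exists_norm_sub_le_min hfc
  have hG : ∀ x y, ‖f x - f y‖ ≤ M * ‖x - y‖ ^ (s - m) := by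
    intro x y
    refine (hfM x y).trans ?_
    gcongr
    rcases le_total ‖x - y‖ 1 with h1 | h1
    · exact (min_le_left _ _).trans
        (Real.self_le_rpow_of_le_one (norm_nonneg _) h1 (by linarith))
    · exact (min_le_right _ _).trans (Real.one_le_rpow h1 hσ0.le)
  have hfin := lintegral_norm_sub_div_rpow_lt_top hn hσ0 (by linarith) hf hfc
  set I := ∫⁻ x, ∫⁻ y, ENNReal.ofReal (‖f x - f y‖ / ‖x - y‖ ^ (s - m)) /
    ENNReal.ofReal (‖x - y‖ ^ (n : ℝ))
  set κ := I.toReal + 1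
  have hκ : 0 < κ := by positivity
  have hIκ : I ≤ ENNReal.ofReal κ := by
    rw [← ENNReal.ofReal_toReal hfin.ne]
    exact ENNReal.ofReal_le_ofReal (by linarith)
  set lam := δ / (2 * c')
  have hlam : 0 < lam := by positivity
  refine ⟨M / κ * (lam / M) ^ ((n : ℝ) / s), by positivity, fun t ht => ?_⟩
  rcases eq_or_ne (A t) ⊤ with htop | htop
  · simp [htop]
  set r := (M / (lam * t)) ^ s⁻¹
  have hr : 0 < r := by positivity
  have hrs : r ^ s = M / (lam * t) := Real.rpow_inv_rpow (by positivity) hs0.ne'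
  have hrn : r ^ n = (M / (lam * t)) ^ ((n : ℝ) / s) := by
    rw [← Real.rpow_natCast, ← Real.rpow_mul (by positivity), div_eq_inv_mul (n : ℝ)]
  have hT : M / (lam * r ^ s) = t := by
    rw [hrs]
    field_simp
  set v : Euc n → ℝ := fun x => u (r⁻¹ • x)
  have hv : ContDiff ℝ (⊤ : ℕ∞) v := hu.comp (contDiff_const_smul r⁻¹)
  have hvc : HasCompactSupport v := huc.comp_smul (inv_pos.2 hr).ne'
  have hJ := Jfun_comp_smul_le (m := m) (s := s) hM hr hlam hA hG (by rwa [hT])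
  rw [hT] at hJ
  have hgt : 1 < Jfun n (s - m) A (fun x i => r⁻¹ ^ m * G (r⁻¹ • x) i / lam) := by
    by_contra! hle
    have hsem : fracSem n (s - m) A (iterPartial v m) ≤ ENNReal.ofReal lam := by
      refine sInf_le ⟨lam, ⟨hlam, ?_⟩, rfl⟩
      simpa only [v, iterPartial_comp_smul] using hle
    have h1 := h v (iterPartial v) (hasWeakDerivs_iterPartial hv hvc m)
      (decayFrom_iterPartial hvc 1 m) (hsem.trans_lt ENNReal.ofReal_lt_top)
    have h2 : ENNReal.ofReal δ ≤ campSem n (fun _ => 1) v := by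
      have h3 : oscQuot n (fun _ => 1) v 0 (r * 3) = δ := oscQuot_comp_smul u hr three_pos
      rw [← h3]
      exact le_iSup₂_of_le (0 : Euc n) (r * 3) (le_iSup_of_le (by positivity) le_rfl)
    have h4 := h2.trans (h1.trans (mul_le_mul' le_rfl hsem))
    rw [← ENNReal.ofReal_mul hc'.le, ENNReal.ofReal_le_ofReal_iff (by positivity)] at h4
    have h5 : c' * lam = δ / 2 := by
      simp only [lam]
      field_simp
    linarith
  have h6 : 1 ≤ A t * ENNReal.ofReal (r ^ n / M * κ) := by
    rw [ENNReal.ofReal_mul (by positivity)]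
    exact (hgt.le.trans hJ).trans (by gcongr)
  have h7 : ENNReal.ofReal (r ^ n / M * κ)⁻¹ ≤ A t := by
    rw [ENNReal.ofReal_inv_of_pos (by positivity)]
    exact (ENNReal.inv_le_iff_le_mul (fun h => absurd h htop) (by simp)).2
      (h6.trans_eq (mul_comm _ _))
  refine le_trans (le_of_eq ?_) h7
  congr 1
  rw [hrn, Real.div_rpow hM.le (by positivity), Real.mul_rpow hlam.le ht.le,
    Real.div_rpow hlam.le hM.le]
  field_simp

/-- `V^{s,A}_{d,1}(ℝⁿ) → BMO(ℝⁿ)` if and only if either `s < n` and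
`∫_0^t Ã(τ) τ^{-1-n/(n+1-s)} dτ ≤ c t^{n/((n-s)(n+1-s))}` for all `t > 0`, or `s = n`
and `A(t) ≥ c t` near zero. -/
theorem stmt9 (n : ℕ) (hn : 0 < n) (s : ℝ) (hs : s ∈ Set.Ioo (1 : ℝ) ((n : ℝ) + 1))
    (hs2 : ∀ m : ℕ, s ≠ (m : ℝ)) (A : ℝ → ℝ≥0∞) (hA : IsYoung A) :
    (∃ c' : ℝ, 0 < c' ∧
        ∀ (u : Euc n → ℝ) (D : (h : ℕ) → Euc n → (Fin h → Fin n) → ℝ),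
          HasWeakDerivs n ⌊s⌋₊ u D → DecayFrom n 1 ⌊s⌋₊ D →
          fracSem n (s - (⌊s⌋₊ : ℝ)) A (D ⌊s⌋₊) < ⊤ →
          campSem n (fun _ => 1) u ≤
            ENNReal.ofReal c' * fracSem n (s - (⌊s⌋₊ : ℝ)) A (D ⌊s⌋₊)) ↔
    ((s < (n : ℝ) ∧ ∃ c : ℝ, 0 < c ∧ ∀ t : ℝ, 0 < t →
        (∫⁻ τ in Set.Ioc (0 : ℝ) t,
            youngConj A τ * ENNReal.ofReal (τ ^ (-1 - (n : ℝ) / ((n : ℝ) + 1 - s)))) ≤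
          ENNReal.ofReal (c * t ^ ((n : ℝ) / (((n : ℝ) - s) * ((n : ℝ) + 1 - s))))) ∨
      (s = (n : ℝ) ∧ ∃ c t₀ : ℝ, 0 < c ∧ 0 < t₀ ∧
        ∀ t ∈ Set.Icc (0 : ℝ) t₀, ENNReal.ofReal (c * t) ≤ A t)) := by
  have hs0 : 0 < s := one_pos.trans hs.1
  have hm : (⌊s⌋₊ : ℝ) < s := lt_of_le_of_ne (Nat.floor_le hs0.le) (hs2 _).symm
  constructor
  · rintro ⟨c', hc', h⟩
    have hpow := exists_rpow_le_of_campSem_le hn hm (Nat.lt_floor_add_one s) hA hc' h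
    obtain ⟨c, hc, hcA⟩ := hpow
    have h1 : 1 ≤ (n : ℝ) / s := hA.one_le_of_rpow_le hc hcA
    have hsn : s < n := lt_of_le_of_ne ((one_le_div hs0).1 h1) (hs2 n)
    exact Or.inl ⟨hsn, (rpow_le_iff_integral_youngConj_le hs.1 hsn).1 ⟨c, hc, hcA⟩⟩
  · rintro (⟨hsn, h⟩ | ⟨hsn, -⟩)
    · obtain ⟨c, hc, hcA⟩ := (rpow_le_iff_integral_youngConj_le hs.1 hsn).2 h
      obtain ⟨c', hc', h'⟩ := exists_campSem_le_of_rpow_le hn hm hsn hc hcA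
      exact ⟨c', hc', fun u D hD hdec _ => h' u D hD hdec⟩
    · exact absurd hsn (hs2 n)
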